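/- arXiv:1405.4569 — 3 statements merged into one kernel-verified Lean document; each statement's English description precedes it below -/
import Mathlib

section
/- Weierstrass-type factorization with analytic roots. Let F : ℂ × ℂ → ℂ be analytic on a neighborhood of (0, 0) with F(0, 0) = 0, and suppose that whenever (z, t) lies in this neighborhood with F(z, t) = 0 and t real, then z is real. Then there exist an integer m ≥ 1, a function G analytic on a neighborhood of (0, 0) with G(0, 0) ≠ 0, and functions g₁, …, g_m analytic on a neighborhood of 0 in ℂ with g_ν(0) = 0 for each ν, such that F(z, t) = G(z, t) · ∏_{ν=1}^{m} (z − g_ν(t)) for all (z, t) in a neighborhood of (0, 0). -/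
open Filter Topology


/-- Averaging an analytic function along `s ↦ (s z, t)` gives an analytic function. -/
lemma wf_avg {K : ℂ × ℂ → ℂ} (hK : AnalyticAt ℂ K 0) :
    AnalyticAt ℂ (fun x : ℂ × ℂ => ∫ s in (0:ℝ)..1, K ((s:ℂ) * x.1, x.2)) 0 := by
  obtain ⟨P, r, hP⟩ := hK
  let L : ℝ → (ℂ × ℂ →L[ℂ] ℂ × ℂ) := fun s =>
    ((s:ℂ) • ContinuousLinearMap.fst ℂ ℂ ℂ).prod (ContinuousLinearMap.snd ℂ ℂ ℂ)
  have hLapp : ∀ s x, L s x = ((s:ℂ) * x.1, x.2) := fun s x => by simp [L]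
  have hLeq : ∀ s, L s = (s:ℂ) • (ContinuousLinearMap.inl ℂ ℂ ℂ ∘L ContinuousLinearMap.fst ℂ ℂ ℂ)
      + (ContinuousLinearMap.inr ℂ ℂ ℂ ∘L ContinuousLinearMap.snd ℂ ℂ ℂ) := by
    intro s; ext <;> simp [L]
  have hLc : Continuous L := by
    have : L = fun s => _ := funext hLeq
    rw [this]; fun_prop
  have hLx : ∀ s ∈ Set.Icc (0:ℝ) 1, ∀ x, ‖L s x‖ ≤ ‖x‖ := by
    intro s hs x
    rw [hLapp, Prod.norm_def, Prod.norm_def]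
    refine max_le_max ?_ le_rfl
    rw [norm_mul, Complex.norm_real, Real.norm_of_nonneg hs.1]
    exact mul_le_of_le_one_left (norm_nonneg _) hs.2
  have hLn : ∀ s ∈ Set.Icc (0:ℝ) 1, ‖L s‖ ≤ 1 := by
    intro s hs
    refine ContinuousLinearMap.opNorm_le_bound _ zero_le_one fun x => ?_
    simpa using hLx s hs x
  let T : (n : ℕ) → ℝ → ContinuousMultilinearMap ℂ (fun _ : Fin n => ℂ × ℂ) ℂ := fun n s =>
    (P n).compContinuousLinearMap (fun _ => L s)
  have hTc : ∀ n, Continuous (T n) := by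
    intro n
    have h1 := (ContinuousMultilinearMap.compContinuousLinearMapContinuousMultilinear ℂ
      (fun _ : Fin n => ℂ × ℂ) (fun _ : Fin n => ℂ × ℂ) ℂ).cont
    have h2 : Continuous (fun s : ℝ => (fun _ : Fin n => L s)) := continuous_pi fun _ => hLc
    exact (h1.comp h2).clm_apply continuous_const
  have hTn : ∀ n, ∀ s ∈ Set.Icc (0:ℝ) 1, ‖T n s‖ ≤ ‖P n‖ := by
    intro n s hs
    refine (ContinuousMultilinearMap.norm_compContinuousLinearMap_le _ _).trans ?_
    refine mul_le_of_le_one_right (norm_nonneg _) ?_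
    exact Finset.prod_le_one (fun _ _ => norm_nonneg _) (fun _ _ => hLn s hs)
  have hsub : ∀ s, s ∈ Set.uIoc (0:ℝ) 1 → s ∈ Set.Icc (0:ℝ) 1 := by
    intro s hs
    rw [Set.uIoc_of_le zero_le_one] at hs
    exact ⟨hs.1.le, hs.2⟩
  let q : FormalMultilinearSeries ℂ (ℂ × ℂ) ℂ := fun n => ∫ s in (0:ℝ)..1, T n s
  have hq : ∀ n, ‖q n‖ ≤ ‖P n‖ := by
    intro n
    have := intervalIntegral.norm_integral_le_of_norm_le_const (a := (0:ℝ)) (b := 1)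
      (f := T n) (C := ‖P n‖) (fun s hs => hTn n s (hsub s hs))
    simpa using this
  refine ⟨q, r, ?_, hP.r_pos, ?_⟩
  · exact hP.r_le.trans (FormalMultilinearSeries.radius_le_of_le (fun n => hq n))
  · intro y hy
    have happ : ∀ n, q n (fun _ => y) = ∫ s in (0:ℝ)..1, T n s (fun _ => y) := by
      intro n
      exact ((ContinuousMultilinearMap.apply ℂ (fun _ : Fin n => ℂ × ℂ) ℂ
        (fun _ => y)).intervalIntegral_comp_comm ((hTc n).intervalIntegrable 0 1)).symm
    have hTy : ∀ n s, T n s (fun _ => y) = P n (fun _ => L s y) := fun n s => rfl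
    simp only [happ, zero_add]
    have hyn : (‖y‖₊ : ENNReal) < P.radius := by
      refine lt_of_lt_of_le ?_ hP.r_le
      simpa [edist_zero_right, enorm_eq_nnnorm] using hy
    have hsum := P.summable_norm_mul_pow hyn
    refine intervalIntegral.hasSum_integral_of_dominated_convergence
      (fun n _ => ‖P n‖ * ‖y‖ ^ n) ?_ ?_ ?_ ?_ ?_
    · intro n
      have : Continuous fun s => T n s (fun _ => y) :=
        (ContinuousMultilinearMap.apply ℂ (fun _ : Fin n => ℂ × ℂ) ℂ
          (fun _ => y)).continuous.comp (hTc n)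
      exact this.aestronglyMeasurable
    · intro n
      refine Eventually.of_forall fun s hs => ?_
      refine ((T n s).le_opNorm _).trans ?_
      simp only [Finset.prod_const, Finset.card_univ, Fintype.card_fin]
      gcongr
      exact hTn n s (hsub s hs)
    · exact Eventually.of_forall fun s hs => hsum
    · exact intervalIntegrable_const
    · refine Eventually.of_forall fun s hs => ?_
      have hmem : L s y ∈ Metric.eball (0 : ℂ × ℂ) r := by
        have h1 := hLx s (hsub s hs) y
        have h2 : edist (L s y) 0 ≤ edist y 0 := by
          rw [edist_zero_right, edist_zero_right]
          exact enorm_le_iff_norm_le.2 h1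
        exact lt_of_le_of_lt h2 hy
      have := hP.hasSum hmem
      simpa [hTy, hLapp] using this

/-- Partial derivatives of all orders in the first variable are analytic. -/
lemma wf_partial {F : ℂ × ℂ → ℂ} {x : ℂ × ℂ} (hF : AnalyticAt ℂ F x) (n : ℕ) :
    AnalyticAt ℂ (fun y : ℂ × ℂ => iteratedDeriv n (fun z => F (z, y.2)) y.1) x := by
  induction n with
  | zero => simpa using hF
  | succ n ih =>
    have h1 : AnalyticAt ℂ (fun y : ℂ × ℂ =>
        fderiv ℂ (fun y : ℂ × ℂ => iteratedDeriv n (fun z => F (z, y.2)) y.1) y (1, 0)) x :=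
      (ContinuousLinearMap.apply ℂ ℂ ((1, 0) : ℂ × ℂ)).analyticAt _ |>.comp ih.fderiv
    refine h1.congr ?_
    filter_upwards [ih.eventually_analyticAt] with y hy
    rw [iteratedDeriv_succ]
    have h2 : HasDerivAt (fun z : ℂ => (z, y.2)) ((1, 0) : ℂ × ℂ) y.1 :=
      (hasDerivAt_id y.1).prodMk (hasDerivAt_const y.1 y.2)
    exact (hy.differentiableAt.hasFDerivAt.comp_hasDerivAt (f := fun z : ℂ => (z, y.2))
      y.1 h2).deriv.symm

/-- Division by the first variable. -/
lemma wf_div {F : ℂ × ℂ → ℂ} (hF : AnalyticAt ℂ F 0) :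
    ∃ F1 : ℂ × ℂ → ℂ, AnalyticAt ℂ F1 0 ∧
      ∀ᶠ x : ℂ × ℂ in 𝓝 0, F x = F (0, x.2) + x.1 * F1 x := by
  have hD := wf_partial hF 1
  refine ⟨_, wf_avg hD, ?_⟩
  obtain ⟨ε, hε, hb⟩ := Metric.eventually_nhds_iff_ball.1
    (hF.eventually_analyticAt.and hD.eventually_analyticAt)
  filter_upwards [Metric.ball_mem_nhds (0 : ℂ × ℂ) hε] with x hx
  have hmem : ∀ s ∈ Set.uIcc (0:ℝ) 1, ((s:ℂ) * x.1, x.2) ∈ Metric.ball (0 : ℂ × ℂ) ε := by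
    intro s hs
    rw [Set.uIcc_of_le zero_le_one] at hs
    rw [mem_ball_zero_iff, Prod.norm_def, max_lt_iff] at *
    refine ⟨lt_of_le_of_lt ?_ hx.1, hx.2⟩
    rw [norm_mul, Complex.norm_real, Real.norm_of_nonneg hs.1]
    exact mul_le_of_le_one_left (norm_nonneg _) hs.2
  have hder : ∀ s ∈ Set.uIcc (0:ℝ) 1, HasDerivAt (fun s : ℝ => F ((s:ℂ) * x.1, x.2))
      (x.1 * iteratedDeriv 1 (fun z => F (z, x.2)) ((s:ℂ) * x.1)) s := by
    intro s hs
    have h0 : HasDerivAt (fun s : ℝ => (s:ℂ) * x.1) (1 * x.1) s :=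
      (Complex.ofRealCLM.hasDerivAt (x := s)).mul_const x.1
    have h1 : DifferentiableAt ℂ (fun z => F (z, x.2)) ((s:ℂ) * x.1) := by
      have := (hb _ (hmem s hs)).1.differentiableAt
      exact DifferentiableAt.comp (g := F) (f := fun z : ℂ => (z, x.2)) _ this (by fun_prop)
    have h2 := h1.hasDerivAt.comp_of_eq s h0 rfl
    simpa [iteratedDeriv_one, mul_comm, Function.comp_def] using h2
  have hcont : ContinuousOn (fun s : ℝ => x.1 * iteratedDeriv 1 (fun z => F (z, x.2)) ((s:ℂ) * x.1))
      (Set.uIcc (0:ℝ) 1) := by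
    intro s hs
    have h1 := (hb _ (hmem s hs)).2.continuousAt
    have h2 : ContinuousAt (fun s : ℝ => ((s:ℂ) * x.1, x.2)) s := by fun_prop
    exact (continuousAt_const.mul
      (ContinuousAt.comp (g := fun y : ℂ × ℂ => iteratedDeriv 1 (fun z => F (z, y.2)) y.1)
        (f := fun s : ℝ => ((s:ℂ) * x.1, x.2)) (x := s) h1 h2)).continuousWithinAt
  have hint := intervalIntegral.integral_eq_sub_of_hasDerivAt hder hcont.intervalIntegrable
  rw [intervalIntegral.integral_const_mul] at hint
  simp only [Complex.ofReal_one, one_mul, Complex.ofReal_zero, zero_mul] at hint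
  simp only [hint]
  ring

lemma wf_slice {F : ℂ × ℂ → ℂ} {z t : ℂ} (hF : AnalyticAt ℂ F (z, t)) :
    AnalyticAt ℂ (fun z => F (z, t)) z :=
  AnalyticAt.comp (g := F) (f := fun z : ℂ => (z, t)) hF (by fun_prop)

lemma wf_leib {f K : ℂ → ℂ} {c : ℂ} (hK : AnalyticAt ℂ K 0)
    (h : ∀ᶠ z in 𝓝 (0:ℂ), f z = c + z * K z) (n : ℕ) :
    iteratedDeriv (n + 1) f 0 = (n + 1) * iteratedDeriv n K 0 := by
  have h1 : iteratedDeriv (n + 1) f 0 = iteratedDeriv (n + 1) (fun z => c + z * K z) 0 :=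
    Filter.EventuallyEq.iteratedDeriv_eq (n + 1) h
  rw [h1]
  have h2 : iteratedDeriv (n + 1) (fun z => c + z * K z) 0
      = iteratedDeriv (n + 1) (fun z => z * K z) 0 := by
    rw [iteratedDeriv_succ', iteratedDeriv_succ']
    congr 1
    ext z
    simp
  rw [h2, iteratedDeriv_fun_mul (by fun_prop) hK.contDiffAt, Finset.sum_range_succ',
    Finset.sum_range_succ']
  rw [Finset.sum_eq_zero]
  · simp [iteratedDeriv_one]
  · intro i hi
    have : iteratedDeriv (i + 1 + 1) (fun z : ℂ => z) 0 = 0 := by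
      rw [iteratedDeriv_succ', iteratedDeriv_succ']
      simp
    rw [this]; simp

/-- Slice version of an eventual statement. -/
lemma wf_evslice {p : ℂ × ℂ → Prop} (h : ∀ᶠ x in 𝓝 (0 : ℂ × ℂ), p x) :
    ∀ᶠ t in 𝓝 (0:ℂ), ∀ᶠ z in 𝓝 (0:ℂ), p (z, t) := by
  have h1 : ∀ᶠ x in 𝓝 ((0:ℂ), (0:ℂ)), p (x.2, x.1) := by
    have : Tendsto (fun x : ℂ × ℂ => (x.2, x.1)) (𝓝 ((0:ℂ), (0:ℂ))) (𝓝 (0 : ℂ × ℂ)) := by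
      have : Continuous (fun x : ℂ × ℂ => (x.2, x.1)) := by fun_prop
      exact this.tendsto' _ _ rfl
    exact this.eventually h
  rw [nhds_prod_eq] at h1
  exact h1.curry

/-- Taylor coefficients in the first variable. -/
noncomputable def wfCoef (F : ℂ × ℂ → ℂ) (j : ℕ) (t : ℂ) : ℂ :=
  iteratedDeriv j (fun z => F (z, t)) 0 / (j.factorial : ℂ)

lemma wfCoef_analytic {F : ℂ × ℂ → ℂ} (hF : AnalyticAt ℂ F 0) (j : ℕ) :
    AnalyticAt ℂ (wfCoef F j) 0 := by
  have h := wf_partial hF j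
  have h2 : AnalyticAt ℂ (fun t : ℂ => iteratedDeriv j (fun z => F (z, t)) 0) 0 :=
    AnalyticAt.comp (g := fun y : ℂ × ℂ => iteratedDeriv j (fun z => F (z, y.2)) y.1)
      (f := fun t : ℂ => ((0:ℂ), t)) h (by fun_prop)
  exact h2.div_const

lemma wf_taylor (m : ℕ) : ∀ {F : ℂ × ℂ → ℂ}, AnalyticAt ℂ F 0 →
    ∃ H : ℂ × ℂ → ℂ, AnalyticAt ℂ H 0 ∧ ∀ᶠ x : ℂ × ℂ in 𝓝 0,
      F x = ∑ j ∈ Finset.range m, wfCoef F j x.2 * x.1 ^ j + x.1 ^ m * H x := by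
  induction m with
  | zero => intro F hF; exact ⟨F, hF, by simp⟩
  | succ m ih =>
    intro F hF
    obtain ⟨F1, hF1, h1⟩ := wf_div hF
    obtain ⟨H, hH, h2⟩ := ih hF1
    refine ⟨H, hH, ?_⟩
    have h3 : ∀ᶠ t in 𝓝 (0:ℂ), ∀ j, wfCoef F (j + 1) t = wfCoef F1 j t := by
      have hs : ∀ᶠ t in 𝓝 (0:ℂ), AnalyticAt ℂ F1 ((0:ℂ), t) := by
        have : ContinuousAt (fun t : ℂ => ((0:ℂ), t)) 0 := by fun_prop
        exact this.eventually hF1.eventually_analyticAt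
      filter_upwards [wf_evslice h1, hs] with t ht hst j
      unfold wfCoef
      rw [wf_leib (c := F (0, t)) (K := fun z => F1 (z, t)) (wf_slice hst) ht j,
        Nat.factorial_succ]
      have : ((j:ℂ) + 1) ≠ 0 := Nat.cast_add_one_ne_zero j
      have : (j.factorial : ℂ) ≠ 0 := by exact_mod_cast j.factorial_ne_zero
      push_cast
      field_simp
    have h3' : ∀ᶠ x : ℂ × ℂ in 𝓝 0, ∀ j, wfCoef F (j + 1) x.2 = wfCoef F1 j x.2 :=
      (continuous_snd.tendsto' (0 : ℂ × ℂ) (0:ℂ) rfl).eventually h3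
    filter_upwards [h1, h2, h3'] with x h1 h2 h3
    rw [h1, h2, Finset.sum_range_succ', mul_add, Finset.mul_sum]
    simp only [h3]
    have : wfCoef F 0 x.2 = F (0, x.2) := by simp [wfCoef]
    rw [this, pow_zero, mul_one, add_comm (∑ j ∈ _, _) (F _), add_assoc]
    congr 2
    · refine Finset.sum_congr rfl fun i _ => by ring
    · ring

/-- Implicit function theorem. -/
lemma wf_ift {F : ℂ × ℂ → ℂ} (hF : AnalyticAt ℂ F 0) (h0 : F 0 = 0)
    (hd : deriv (fun z => F (z, 0)) 0 ≠ 0) :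
    ∃ h : ℂ → ℂ, AnalyticAt ℂ h 0 ∧ h 0 = 0 ∧ ∀ᶠ t in 𝓝 (0:ℂ), F (h t, t) = 0 := by
  let f : ℂ × ℂ → ℂ := fun x => F (x.2, x.1)
  have hf : AnalyticAt ℂ f ((0:ℂ), (0:ℂ)) :=
    AnalyticAt.comp (g := F) (f := fun x : ℂ × ℂ => (x.2, x.1)) hF
      (AnalyticAt.prod analyticAt_snd analyticAt_fst)
  have hval : ∀ w, (fderiv ℂ f ((0:ℂ), (0:ℂ)) ∘L .inr ℂ ℂ ℂ) w
      = w * deriv (fun z => F (z, 0)) 0 := by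
    intro w
    have h2 : HasDerivAt (fun z : ℂ => ((0:ℂ), z)) ((0, 1) : ℂ × ℂ) 0 :=
      (hasDerivAt_const (0:ℂ) (0:ℂ)).prodMk (hasDerivAt_id (0:ℂ))
    have h3 := (hf.differentiableAt.hasFDerivAt.comp_hasDerivAt (f := fun z : ℂ => ((0:ℂ), z))
      (0:ℂ) h2).deriv
    have h4 : deriv (fun z => F (z, 0)) 0 = fderiv ℂ f ((0:ℂ), (0:ℂ)) (0, 1) := h3
    rw [h4]
    have : ((0:ℂ), w) = w • ((0:ℂ), (1:ℂ)) := by simp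
    simp only [ContinuousLinearMap.comp_apply, ContinuousLinearMap.inr_apply]
    rw [this, map_smul, smul_eq_mul]
  have hinv : (fderiv ℂ f ((0:ℂ), (0:ℂ)) ∘L .inr ℂ ℂ ℂ).IsInvertible := by
    refine ⟨ContinuousLinearEquiv.unitsEquivAut ℂ (Units.mk0 _ hd), ?_⟩
    ext
    rw [hval]
    simp
  have hc : ContDiffAt ℂ ⊤ f ((0:ℂ), (0:ℂ)) := hf.contDiffAt
  have hne : (⊤ : WithTop ℕ∞) ≠ 0 := by simp
  refine ⟨hc.implicitFunction hne hinv, ?_, ?_, ?_⟩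
  · exact (hc.contDiffAt_implicitFunction hne hinv).analyticAt
  · exact hc.implicitFunction_apply_self hne hinv
  · filter_upwards [hc.eventually_apply_implicitFunction hne hinv] with t ht
    exact ht.trans h0

/-- Minimum modulus principle: existence of a zero. -/
lemma wf_minmod {f : ℂ → ℂ} {w : ℂ} {r ε : ℝ} (hr : 0 < r)
    (hf : DifferentiableOn ℂ f (Metric.closedBall w r))
    (hs : ∀ z ∈ Metric.sphere w r, ε ≤ ‖f z‖) (hw : ‖f w‖ < ε) :
    ∃ z ∈ Metric.closedBall w r, f z = 0 := by
  by_contra! hcon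
  have hε : 0 < ε := (norm_nonneg _).trans_lt hw
  have hd : DiffContOnCl ℂ (fun z => (f z)⁻¹) (Metric.ball w r) := by
    refine DifferentiableOn.diffContOnCl ?_
    rw [closure_ball w hr.ne']
    exact hf.inv hcon
  have := Complex.norm_le_of_forall_mem_frontier_norm_le Metric.isBounded_ball hd (C := ε⁻¹)
    (fun z hz => by
      rw [frontier_ball w hr.ne'] at hz
      rw [norm_inv]
      exact inv_anti₀ hε (hs z hz)) (subset_closure (Metric.mem_ball_self hr))
  rw [norm_inv] at this
  have hpos : 0 < ‖f w‖ := norm_pos_iff.2 (hcon w (Metric.mem_closedBall_self hr.le))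
  have := (inv_le_inv₀ hpos hε).1 this
  linarith

/-- Hurwitz: zeros persist. -/
lemma wf_hurwitz {F : ℂ × ℂ → ℂ} {w : ℂ} (hF : AnalyticAt ℂ F (w, 0)) (h0 : F (w, 0) = 0)
    (hne : ¬ ∀ᶠ z in 𝓝 w, F (z, 0) = 0) {ε : ℝ} (hε : 0 < ε) :
    ∀ᶠ s in 𝓝 (0:ℂ), ∃ z ∈ Metric.closedBall w ε, F (z, s) = 0 := by
  obtain ⟨δ, hδ, hb⟩ := Metric.eventually_nhds_iff_ball.1 hF.eventually_analyticAt
  have hiso := ((wf_slice hF).eventually_eq_zero_or_eventually_ne_zero).resolve_left hne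
  rw [eventually_nhdsWithin_iff] at hiso
  obtain ⟨η, hη, hb2⟩ := Metric.eventually_nhds_iff_ball.1 hiso
  let r := min ε (min (δ / 2) (η / 2))
  have hr : 0 < r := by positivity
  have hrε : r ≤ ε := min_le_left _ _
  have hrδ : r < δ := lt_of_le_of_lt ((min_le_right _ _).trans (min_le_left _ _)) (by linarith)
  have hrη : r < η := lt_of_le_of_lt ((min_le_right _ _).trans (min_le_right _ _)) (by linarith)
  have hcontAt : ∀ z ∈ Metric.closedBall w r, ∀ s ∈ Metric.ball (0:ℂ) δ,
      AnalyticAt ℂ F (z, s) := by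
    intro z hz s hs
    refine hb _ ?_
    rw [← ball_prod_same]
    exact ⟨lt_of_le_of_lt hz hrδ, hs⟩
  have hcs : IsCompact (Metric.sphere w r) := isCompact_sphere w r
  have hcont0 : ContinuousOn (fun z => ‖F (z, 0)‖) (Metric.sphere w r) := by
    intro z hz
    have := wf_slice (hcontAt z (Metric.sphere_subset_closedBall hz) 0 (Metric.mem_ball_self hδ))
    exact this.continuousAt.norm.continuousWithinAt
  have hnes : (Metric.sphere w r).Nonempty := NormedSpace.sphere_nonempty.2 hr.le
  obtain ⟨z0, hz0, hmin⟩ := hcs.exists_isMinOn hnes hcont0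
  have hpos : 0 < ‖F (z0, 0)‖ := by
    refine norm_pos_iff.2 (hb2 z0 ?_ ?_)
    · rw [Metric.mem_ball, Metric.mem_sphere.1 hz0]; exact hrη
    · rintro rfl
      simp at hz0
      linarith
  set c := ‖F (z0, 0)‖
  have hev : ∀ᶠ s in 𝓝 (0:ℂ), ∀ z ∈ Metric.sphere w r, c / 2 < ‖F (z, s)‖ := by
    refine hcs.eventually_forall_of_forall_eventually fun z hz => ?_
    have h1 := (hcontAt z (Metric.sphere_subset_closedBall hz) 0 (Metric.mem_ball_self hδ))
    have h2 : ContinuousAt (fun x : ℂ × ℂ => ‖F (x.2, x.1)‖) (0, z) := by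
      have h3 : ContinuousAt (fun x : ℂ × ℂ => (x.2, x.1)) (0, z) := by fun_prop
      exact (ContinuousAt.comp (g := F) (f := fun x : ℂ × ℂ => (x.2, x.1)) (x := (0, z))
        h1.continuousAt h3).norm
    have h4 : c / 2 < ‖F (z, 0)‖ := lt_of_lt_of_le (by linarith) (hmin hz)
    exact h2.eventually (lt_mem_nhds h4)
  have hev2 : ∀ᶠ s in 𝓝 (0:ℂ), ‖F (w, s)‖ < c / 2 := by
    have h3 : ContinuousAt (fun s : ℂ => (w, s)) 0 := by fun_prop
    have h2 := (ContinuousAt.comp (g := F) (f := fun s : ℂ => (w, s)) (x := 0)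
        hF.continuousAt h3).norm
    refine h2.eventually (gt_mem_nhds ?_)
    simp [h0, hpos]
  filter_upwards [hev, hev2, Metric.ball_mem_nhds (0:ℂ) hδ] with s hs1 hs2 hs3
  obtain ⟨z, hz, hz0⟩ := wf_minmod (f := fun z => F (z, s)) hr
    (fun z hz => (wf_slice (hcontAt z hz s hs3)).differentiableAt.differentiableWithinAt)
    (fun z hz => (hs1 z hz).le) hs2
  exact ⟨z, Metric.closedBall_subset_closedBall hrε hz, hz0⟩

lemma wf_poly_mult {Q : Polynomial ℂ} {m i : ℕ} (hm : Q.natDegree = m)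
    (hc : Q.coeff (m - 1) = 0) (hi : i < m) (hQi : Q.coeff i ≠ 0) (w : ℂ) :
    Q.rootMultiplicity w < m := by
  have hQ : Q ≠ 0 := by rintro rfl; simp at hQi
  by_contra! hcon
  obtain ⟨R, hR⟩ := (Polynomial.le_rootMultiplicity_iff hQ).1 hcon
  have hR0 : R ≠ 0 := by rintro rfl; simp at hR; exact hQ hR
  have hmon : ((Polynomial.X - Polynomial.C w) ^ m).Monic := (Polynomial.monic_X_sub_C w).pow m
  have hdeg : R.natDegree = 0 := by
    have := congrArg Polynomial.natDegree hR
    rw [hmon.natDegree_mul' hR0, Polynomial.natDegree_pow, Polynomial.natDegree_X_sub_C, hm] at this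
    omega
  rw [Polynomial.eq_C_of_natDegree_eq_zero hdeg] at hR hR0
  set c := R.coeff 0
  have hc0 : c ≠ 0 := by rintro h; simp [h] at hR0
  have hcf : ∀ k, ((Polynomial.X - Polynomial.C w) ^ m).coeff k = (-w) ^ (m - k) * m.choose k := by
    intro k
    have : Polynomial.X - Polynomial.C w = Polynomial.X + Polynomial.C (-w) := by
      rw [Polynomial.C_neg, sub_eq_add_neg]
    rw [this, Polynomial.coeff_X_add_C_pow]
  have h1 := congrArg (fun P => Polynomial.coeff P (m - 1)) hR
  simp only [Polynomial.coeff_mul_C, hcf, hc] at h1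
  have hmm : m - (m - 1) = 1 := by omega
  have hch : (m.choose (m - 1) : ℂ) ≠ 0 := by
    exact_mod_cast (Nat.choose_pos (by omega)).ne'
  rw [hmm, pow_one] at h1
  have hw : w = 0 := by
    have := h1.symm
    simpa [hc0, hch] using this
  apply hQi
  rw [hR, Polynomial.coeff_mul_C, hcf, hw, neg_zero, zero_pow (by omega)]
  simp

lemma wf_poly_two {Q : Polynomial ℂ} {m i : ℕ} (hm : Q.natDegree = m)
    (hc : Q.coeff (m - 1) = 0) (hi : i < m) (hQi : Q.coeff i ≠ 0) :
    ∃ w0 w1, w0 ≠ w1 ∧ Q.eval w0 = 0 ∧ Q.eval w1 = 0 := by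
  have hQ : Q ≠ 0 := by rintro rfl; simp at hQi
  have hd : Q.degree ≠ 0 := by
    rw [Polynomial.degree_eq_natDegree hQ, hm]
    exact_mod_cast (by omega : m ≠ 0)
  obtain ⟨w0, hw0⟩ := IsAlgClosed.exists_root Q hd
  by_contra! hcon
  have hall : ∀ w ∈ Q.roots, w = w0 := by
    intro w hw
    by_contra hne
    exact hcon w0 w (Ne.symm hne) hw0 ((Polynomial.mem_roots hQ).1 hw)
  have hcard : Q.roots.card = m := by
    rw [← hm]; exact (Polynomial.splits_iff_card_roots.1 (IsAlgClosed.splits Q))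
  have hrep := Multiset.eq_replicate.2 ⟨hcard, hall⟩
  have := wf_poly_mult hm hc hi hQi w0
  rw [← Polynomial.count_roots, hrep, Multiset.count_replicate_self] at this
  exact lt_irrefl _ this

/-- The rescaled function. -/
noncomputable def wfScale (S : Finset ℕ) (n : ℕ → ℕ) (b : ℕ → ℂ → ℂ) (H : ℂ × ℂ → ℂ)
    (m p q : ℕ) (x : ℂ × ℂ) : ℂ :=
  ∑ j ∈ S, x.2 ^ (q * n j - p * (m - j)) * b j (x.2 ^ q) * x.1 ^ j
    + x.1 ^ m * H (x.1 * x.2 ^ p, x.2 ^ q)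

noncomputable def wfQ (S : Finset ℕ) (n : ℕ → ℕ) (b : ℕ → ℂ → ℂ) (H : ℂ × ℂ → ℂ)
    (m p q : ℕ) : Polynomial ℂ :=
  ∑ j ∈ S, Polynomial.C (0 ^ (q * n j - p * (m - j)) * b j 0) * Polynomial.X ^ j
    + Polynomial.C (H 0) * Polynomial.X ^ m

section scale
variable {S : Finset ℕ} {n : ℕ → ℕ} {b : ℕ → ℂ → ℂ} {H : ℂ × ℂ → ℂ} {m p q : ℕ}

lemma wfScale_zero (hp : 1 ≤ p) (hq : 1 ≤ q) (w : ℂ) :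
    wfScale S n b H m p q (w, 0) = (wfQ S n b H m p q).eval w := by
  have hp' : p ≠ 0 := by omega
  have hq' : q ≠ 0 := by omega
  have h00 : ((0:ℂ), (0:ℂ)) = 0 := rfl
  simp only [wfScale, wfQ, Polynomial.eval_add, Polynomial.eval_finsetSum, Polynomial.eval_mul,
    Polynomial.eval_C, Polynomial.eval_pow, Polynomial.eval_X, zero_pow hp', zero_pow hq', mul_zero,
    h00]
  ring

lemma wfScale_analytic (hp : 1 ≤ p) (hq : 1 ≤ q) (hb : ∀ j ∈ S, AnalyticAt ℂ (b j) 0)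
    (hH : AnalyticAt ℂ H 0) (w : ℂ) : AnalyticAt ℂ (wfScale S n b H m p q) (w, 0) := by
  have hp' : p ≠ 0 := by omega
  have hq' : q ≠ 0 := by omega
  have hx1 : AnalyticAt ℂ (fun x : ℂ × ℂ => x.1) (w, 0) := analyticAt_fst
  have hx2 : AnalyticAt ℂ (fun x : ℂ × ℂ => x.2) (w, 0) := analyticAt_snd
  refine AnalyticAt.add (f := fun x : ℂ × ℂ =>
    ∑ j ∈ S, x.2 ^ (q * n j - p * (m - j)) * b j (x.2 ^ q) * x.1 ^ j)
    (g := fun x : ℂ × ℂ => x.1 ^ m * H (x.1 * x.2 ^ p, x.2 ^ q)) ?_ ?_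
  · refine Finset.analyticAt_fun_sum _ fun j hj => ?_
    refine ((hx2.pow _).mul ?_).mul (hx1.pow _)
    refine AnalyticAt.comp_of_eq (g := b j) (f := fun x : ℂ × ℂ => x.2 ^ q) (hb j hj) (hx2.pow _) ?_
    simp [hq']
  · refine (hx1.pow _).mul ?_
    refine AnalyticAt.comp_of_eq (g := H) (f := fun x : ℂ × ℂ => (x.1 * x.2 ^ p, x.2 ^ q)) hH
      ((hx1.mul (hx2.pow _)).prod (hx2.pow _)) ?_
    simp [hp', hq']

lemma wfScale_eq {F : ℂ × ℂ → ℂ} (hp : 1 ≤ p) (hq : 1 ≤ q) (hS : ∀ j ∈ S, j < m)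
    (hle : ∀ j ∈ S, p * (m - j) ≤ q * n j)
    (hF : ∀ᶠ x : ℂ × ℂ in 𝓝 0,
      F x = ∑ j ∈ S, x.2 ^ n j * b j x.2 * x.1 ^ j + x.1 ^ m * H x) (w : ℂ) :
    ∀ᶠ x : ℂ × ℂ in 𝓝 (w, 0),
      F (x.1 * x.2 ^ p, x.2 ^ q) = x.2 ^ (p * m) * wfScale S n b H m p q x := by
  have hp' : p ≠ 0 := by omega
  have hq' : q ≠ 0 := by omega
  have ht : Tendsto (fun x : ℂ × ℂ => (x.1 * x.2 ^ p, x.2 ^ q)) (𝓝 (w, 0)) (𝓝 0) := by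
    have : Continuous (fun x : ℂ × ℂ => (x.1 * x.2 ^ p, x.2 ^ q)) := by fun_prop
    refine this.tendsto' _ _ ?_
    simp [hp', hq']
  filter_upwards [ht.eventually hF] with x hx
  rw [hx, wfScale, mul_add, Finset.mul_sum]
  congr 1
  · refine Finset.sum_congr rfl fun j hj => ?_
    have e : q * n j + p * j = p * m + (q * n j - p * (m - j)) := by
      have h1 := hle j hj
      have h2 : p * m = p * (m - j) + p * j := by
        rw [← mul_add, Nat.sub_add_cancel (hS j hj).le]
      omega
    rw [mul_pow, ← pow_mul, ← pow_mul]
    calc x.2 ^ (q * n j) * b j (x.2 ^ q) * (x.1 ^ j * x.2 ^ (p * j))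
        = x.2 ^ (q * n j + p * j) * b j (x.2 ^ q) * x.1 ^ j := by rw [pow_add]; ring
      _ = _ := by rw [e, pow_add]; ring
  · rw [mul_pow, ← pow_mul]; ring

lemma wfQ_coeff (k : ℕ) : (wfQ S n b H m p q).coeff k =
    (if k ∈ S then 0 ^ (q * n k - p * (m - k)) * b k 0 else 0) + if k = m then H 0 else 0 := by
  simp only [wfQ, Polynomial.coeff_add, Polynomial.finsetSum_coeff, Polynomial.coeff_C_mul,
    Polynomial.coeff_X_pow]
  simp

lemma wfQ_facts (hS : ∀ j ∈ S, j < m - 1) (hH : H 0 ≠ 0) {i : ℕ} (hi : i ∈ S)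
    (hbi : b i 0 ≠ 0) (heq : q * n i = p * (m - i)) :
    (wfQ S n b H m p q).natDegree = m ∧ (wfQ S n b H m p q).coeff (m - 1) = 0 ∧ i < m ∧
      (wfQ S n b H m p q).coeff i ≠ 0 := by
  have him := hS i hi
  refine ⟨?_, ?_, by omega, ?_⟩
  · refine Polynomial.natDegree_eq_of_le_of_coeff_ne_zero ?_ ?_
    · rw [Polynomial.natDegree_le_iff_coeff_eq_zero]
      intro N hN
      rw [wfQ_coeff, if_neg (fun h => by have := hS N h; omega), if_neg (by omega)]
      simp
    · rw [wfQ_coeff, if_neg (fun h => by have := hS m h; omega), if_pos rfl]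
      simpa using hH
  · rw [wfQ_coeff, if_neg (fun h => by have := hS _ h; omega), if_neg (by omega)]
    simp
  · rw [wfQ_coeff, if_pos hi, if_neg (by omega), heq]
    simpa using hbi

end scale

/-- Differences of zeros are real for real nonzero parameter. -/
def wfReal (F : ℂ × ℂ → ℂ) : Prop :=
  ∃ ε > 0, ∀ z z' t : ℂ, ‖z‖ < ε → ‖z'‖ < ε → ‖t‖ < ε → t ≠ 0 → t.im = 0 →
    F (z, t) = 0 → F (z', t) = 0 → (z - z').im = 0

lemma wf_poly_order {Q : Polynomial ℂ} (hQ : Q ≠ 0) (w : ℂ) :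
    analyticOrderAt (fun z => Q.eval (z + w)) 0 = (Q.rootMultiplicity w : ℕ∞) := by
  obtain ⟨R, hR, hnd⟩ := Polynomial.exists_eq_pow_rootMultiplicity_mul_and_not_dvd Q hQ w
  have han : ∀ P : Polynomial ℂ, AnalyticAt ℂ (fun z => P.eval (z + w)) 0 := by
    intro P
    refine Differentiable.analyticAt ?_ 0
    exact P.differentiable.comp (by fun_prop)
  rw [(han Q).analyticOrderAt_eq_natCast]
  refine ⟨fun z => R.eval (z + w), han R, ?_, Eventually.of_forall fun z => ?_⟩
  · intro h
    simp only [zero_add] at h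
    exact hnd (Polynomial.dvd_iff_isRoot.2 h)
  · conv_lhs => rw [hR]
    simp

lemma wf_integral {S : Finset ℕ} {n : ℕ → ℕ} {b : ℕ → ℂ → ℂ} {H : ℂ × ℂ → ℂ} {m p q : ℕ}
    {F : ℂ × ℂ → ℂ} (hp : 1 ≤ p) (hq : 1 ≤ q) (hS : ∀ j ∈ S, j < m)
    (hle : ∀ j ∈ S, p * (m - j) ≤ q * n j)
    (hF : ∀ᶠ x : ℂ × ℂ in 𝓝 0,
      F x = ∑ j ∈ S, x.2 ^ n j * b j x.2 * x.1 ^ j + x.1 ^ m * H x)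
    (hb : ∀ j ∈ S, AnalyticAt ℂ (b j) 0) (hH : AnalyticAt ℂ H 0)
    (hQ : wfQ S n b H m p q ≠ 0) (hreal : wfReal F) {w0 w1 : ℂ} (hne : w0 ≠ w1)
    (h0 : (wfQ S n b H m p q).eval w0 = 0) (h1 : (wfQ S n b H m p q).eval w1 = 0) : q ∣ p := by
  have hp' : p ≠ 0 := by omega
  have hq' : q ≠ 0 := by omega
  obtain ⟨ε, hε, hreal⟩ := hreal
  have key : ∀ w, (wfQ S n b H m p q).eval w = 0 → ∀ η > 0, ∀ᶠ s in 𝓝 (0:ℂ), s ≠ 0 →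
      ∃ z ∈ Metric.closedBall w η, F (z * s ^ p, s ^ q) = 0 ∧ ‖z * s ^ p‖ < ε ∧ ‖s ^ q‖ < ε := by
    intro w hw η hη
    have e1 := wfScale_eq hp hq hS hle hF w
    have e2 : ∀ᶠ x : ℂ × ℂ in 𝓝 (w, 0), ‖x.1 * x.2 ^ p‖ < ε ∧ ‖x.2 ^ q‖ < ε := by
      have c1 : Continuous (fun x : ℂ × ℂ => ‖x.1 * x.2 ^ p‖) := by fun_prop
      have c2 : Continuous (fun x : ℂ × ℂ => ‖x.2 ^ q‖) := by fun_prop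
      refine (c1.continuousAt.eventually (gt_mem_nhds ?_)).and
        (c2.continuousAt.eventually (gt_mem_nhds ?_)) <;> simp [hp', hq', hε]
    obtain ⟨δ, hδ, hball⟩ := Metric.eventually_nhds_iff_ball.1 (e1.and e2)
    have hnz : ¬ ∀ᶠ z in 𝓝 w, wfScale S n b H m p q (z, 0) = 0 := by
      intro hz
      simp only [wfScale_zero hp hq] at hz
      have hinf : {z | (wfQ S n b H m p q).eval z = 0}.Infinite := infinite_of_mem_nhds w hz
      exact hQ (Polynomial.eq_zero_of_infinite_isRoot _ hinf)
    have hh := wf_hurwitz (wfScale_analytic hp hq hb hH w) (by rw [wfScale_zero hp hq, hw]) hnz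
      (ε := min η (δ / 2)) (by positivity)
    filter_upwards [hh, Metric.ball_mem_nhds (0:ℂ) hδ] with s ⟨z, hz, hz0⟩ hs hs0
    have hm : (z, s) ∈ Metric.ball ((w, 0) : ℂ × ℂ) δ := by
      rw [← ball_prod_same]
      refine ⟨lt_of_le_of_lt hz (lt_of_le_of_lt (min_le_right _ _) (half_lt_self hδ)), hs⟩
    obtain ⟨g1, g2, g3⟩ := hball _ hm
    refine ⟨z, Metric.closedBall_subset_closedBall (min_le_left _ _) hz, ?_, g2, g3⟩
    simp only at g1
    rw [g1, hz0, mul_zero]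
  have key2 : ∀ ζ : ℂ, ‖ζ‖ = 1 → (ζ ^ q).im = 0 → ((w0 - w1) * ζ ^ p).im = 0 := by
    intro ζ hζ hζq
    have hbound : ∀ η > 0, |((w0 - w1) * ζ ^ p).im| ≤ 0 + η := by
      intro η hη
      have ht : Tendsto (fun r : ℝ => (r:ℂ) * ζ) (𝓝[>] 0) (𝓝 0) := by
        have : Continuous (fun r : ℝ => (r:ℂ) * ζ) := by fun_prop
        exact (this.tendsto' 0 0 (by simp)).mono_left nhdsWithin_le_nhds
      obtain ⟨r, ⟨hr1, hr2⟩, hr⟩ := ((ht.eventually ((key w0 h0 (η / 2) (by positivity)).and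
        (key w1 h1 (η / 2) (by positivity)))).and self_mem_nhdsWithin).exists
      have hr : (0:ℝ) < r := hr
      have hζ0 : ζ ≠ 0 := by rintro rfl; simp at hζ
      have hs0 : (r:ℂ) * ζ ≠ 0 := mul_ne_zero (by exact_mod_cast hr.ne') hζ0
      obtain ⟨z, hz, hz0, hz1, hz2⟩ := hr1 hs0
      obtain ⟨z', hz', hz0', hz1', -⟩ := hr2 hs0
      have him : (((r:ℂ) * ζ) ^ q).im = 0 := by
        rw [mul_pow, ← Complex.ofReal_pow, Complex.im_ofReal_mul, hζq, mul_zero]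
      have := hreal _ _ _ hz1 hz1' hz2 (pow_ne_zero _ hs0) him hz0 hz0'
      have e : z * ((r:ℂ) * ζ) ^ p - z' * ((r:ℂ) * ζ) ^ p
          = ((r ^ p : ℝ) : ℂ) * ((z - z') * ζ ^ p) := by
        push_cast; ring
      rw [e, Complex.im_ofReal_mul] at this
      have him2 : ((z - z') * ζ ^ p).im = 0 :=
        (mul_eq_zero.1 this).resolve_left (pow_pos hr p).ne'
      have e2 : ((w0 - w1) * ζ ^ p).im = (((w0 - z) - (w1 - z')) * ζ ^ p).im := by
        have : (w0 - w1) * ζ ^ p = ((w0 - z) - (w1 - z')) * ζ ^ p + (z - z') * ζ ^ p := by ring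
        rw [this, Complex.add_im, him2, add_zero]
      rw [e2, zero_add]
      refine (Complex.abs_im_le_norm _).trans ?_
      rw [norm_mul, norm_pow, hζ, one_pow, mul_one]
      refine (norm_sub_le _ _).trans ?_
      rw [Metric.mem_closedBall, dist_comm, dist_eq_norm] at hz hz'
      linarith
    exact abs_eq_zero.1 (le_antisymm (le_of_forall_pos_le_add hbound) (abs_nonneg _))
  have k1 : (w0 - w1).im = 0 := by simpa using key2 1 (by simp) (by simp)
  let θ : ℝ := Real.pi / q
  have hqR : (q:ℝ) ≠ 0 := by exact_mod_cast hq'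
  have hpow : ∀ k : ℕ, Complex.exp (θ * Complex.I) ^ k = Complex.exp ((k * θ : ℝ) * Complex.I) := by
    intro k
    rw [← Complex.exp_nat_mul]; congr 1; push_cast; ring
  have k2 := key2 (Complex.exp (θ * Complex.I)) (Complex.norm_exp_ofReal_mul_I θ) (by
    rw [hpow, Complex.exp_ofReal_mul_I_im]
    have : (q:ℝ) * θ = Real.pi := by simp only [θ]; field_simp
    rw [this, Real.sin_pi])
  rw [hpow, Complex.mul_im, k1, zero_mul, add_zero, Complex.exp_ofReal_mul_I_im] at k2
  have hre : (w0 - w1).re ≠ 0 := by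
    intro h
    exact hne (sub_eq_zero.1 (Complex.ext h k1))
  have k3 := (mul_eq_zero.1 k2).resolve_left hre
  obtain ⟨N, hN⟩ := Real.sin_eq_zero_iff.1 k3
  have hN2 : (N:ℝ) * q = p := by
    have hpi := Real.pi_ne_zero
    simp only [θ] at hN
    field_simp at hN
    linarith
  have hN3 : (p:ℤ) = q * N := by
    have : ((p:ℤ):ℝ) = ((q * N : ℤ) : ℝ) := by push_cast; linarith
    exact_mod_cast this
  exact Int.natCast_dvd_natCast.1 ⟨N, hN3⟩

lemma wf_snd {p : ℂ → Prop} (h : ∀ᶠ t in 𝓝 (0:ℂ), p t) : ∀ᶠ x : ℂ × ℂ in 𝓝 0, p x.2 :=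
  (continuous_snd.tendsto' (0 : ℂ × ℂ) (0:ℂ) rfl).eventually h

lemma wf_normal {F : ℂ × ℂ → ℂ} {m : ℕ} (hF : AnalyticAt ℂ F 0)
    (hord : analyticOrderAt (fun z => F (z, 0)) 0 = m)
    (hcoef : ∀ᶠ t in 𝓝 (0:ℂ), wfCoef F (m - 1) t = 0) :
    ∃ (S : Finset ℕ) (n : ℕ → ℕ) (b : ℕ → ℂ → ℂ) (H : ℂ × ℂ → ℂ),
      (∀ j ∈ S, j < m - 1) ∧ (∀ j ∈ S, 1 ≤ n j) ∧ (∀ j ∈ S, AnalyticAt ℂ (b j) 0) ∧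
      (∀ j ∈ S, b j 0 ≠ 0) ∧ AnalyticAt ℂ H 0 ∧ H 0 ≠ 0 ∧
      ∀ᶠ x : ℂ × ℂ in 𝓝 0, F x = ∑ j ∈ S, x.2 ^ n j * b j x.2 * x.1 ^ j + x.1 ^ m * H x := by
  classical
  have hslice : AnalyticAt ℂ (fun z => F (z, 0)) 0 := wf_slice hF
  obtain ⟨hlow, htop⟩ := (analyticOrderAt_eq_nat_iff_iteratedDeriv_eq_zero hslice).1 hord
  obtain ⟨H', hH', hT⟩ := wf_taylor (m + 1) hF
  have hex : ∀ j, ∃ (k : ℕ) (g : ℂ → ℂ), (¬ ∀ᶠ t in 𝓝 (0:ℂ), wfCoef F j t = 0) →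
      AnalyticAt ℂ g 0 ∧ g 0 ≠ 0 ∧ ∀ᶠ t in 𝓝 (0:ℂ), wfCoef F j t = t ^ k * g t := by
    intro j
    by_cases h : ∀ᶠ t in 𝓝 (0:ℂ), wfCoef F j t = 0
    · exact ⟨0, 0, fun h' => absurd h h'⟩
    · obtain ⟨k, g, h1, h2, h3⟩ :=
        ((wfCoef_analytic hF j).exists_eventuallyEq_pow_smul_nonzero_iff).2 h
      exact ⟨k, g, fun _ => ⟨h1, h2, by simpa using h3⟩⟩
  choose n b hnb using hex
  let S := (Finset.range m).filter (fun j => ¬ ∀ᶠ t in 𝓝 (0:ℂ), wfCoef F j t = 0)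
  have hSm : ∀ j ∈ S, j < m ∧ ¬ ∀ᶠ t in 𝓝 (0:ℂ), wfCoef F j t = 0 := by
    intro j hj; simpa [S] using hj
  refine ⟨S, n, b, fun x => wfCoef F m x.2 + x.1 * H' x, ?_, ?_, ?_, ?_, ?_, ?_, ?_⟩
  · intro j hj
    obtain ⟨h1, h2⟩ := hSm j hj
    have : j ≠ m - 1 := by rintro rfl; exact h2 hcoef
    omega
  · intro j hj
    obtain ⟨h1, h2⟩ := hSm j hj
    obtain ⟨-, h4, h5⟩ := hnb j h2
    by_contra hn
    have hn0 : n j = 0 := by omega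
    have := h5.self_of_nhds
    rw [hn0, pow_zero, one_mul, wfCoef, hlow j h1, zero_div] at this
    exact h4 this.symm
  · intro j hj; exact (hnb j (hSm j hj).2).1
  · intro j hj; exact (hnb j (hSm j hj).2).2.1
  · refine AnalyticAt.add (f := fun x : ℂ × ℂ => wfCoef F m x.2) (g := fun x : ℂ × ℂ => x.1 * H' x)
      ?_ (analyticAt_fst.mul hH')
    exact AnalyticAt.comp_of_eq (g := wfCoef F m) (f := fun x : ℂ × ℂ => x.2)
      (wfCoef_analytic hF m) analyticAt_snd rfl
  · have : (m.factorial : ℂ) ≠ 0 := by exact_mod_cast m.factorial_ne_zero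
    simp only [Prod.fst_zero, Prod.snd_zero, zero_mul, add_zero, wfCoef]
    exact div_ne_zero htop this
  · have hev : ∀ᶠ t in 𝓝 (0:ℂ), ∀ j ∈ Finset.range m,
        wfCoef F j t = if j ∈ S then t ^ n j * b j t else 0 := by
      rw [Finset.eventually_all]
      intro j hj
      by_cases h : j ∈ S
      · simp only [h, if_true]
        exact (hnb j (hSm j h).2).2.2
      · simp only [h, if_false]
        by_contra hc
        exact h (by simp only [S, Finset.mem_filter]; exact ⟨hj, hc⟩)
    filter_upwards [hT, wf_snd hev] with x hx hev
    rw [hx, Finset.sum_range_succ, Finset.sum_congr rfl (g := fun j =>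
      if j ∈ S then x.2 ^ n j * b j x.2 * x.1 ^ j else 0)
      (fun j hj => by rw [hev j hj]; split_ifs <;> simp)]
    rw [← Finset.sum_filter]
    have : (Finset.range m).filter (fun j => j ∈ S) = S := by
      ext j; simp only [Finset.mem_filter, Finset.mem_range]
      exact ⟨fun h => h.2, fun h => ⟨(hSm j h).1, h⟩⟩
    rw [this]
    ring

lemma wf_shift_analytic {F : ℂ × ℂ → ℂ} {h : ℂ → ℂ} (hF : AnalyticAt ℂ F 0)
    (hh : AnalyticAt ℂ h 0) (h0 : h 0 = 0) :
    AnalyticAt ℂ (fun x : ℂ × ℂ => F (x.1 + h x.2, x.2)) 0 := by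
  refine AnalyticAt.comp_of_eq (g := F) (f := fun x : ℂ × ℂ => (x.1 + h x.2, x.2)) hF
    (AnalyticAt.prod (analyticAt_fst.add ?_) analyticAt_snd) (by simp [h0])
  exact AnalyticAt.comp_of_eq (g := h) (f := fun x : ℂ × ℂ => x.2) hh analyticAt_snd rfl

lemma wf_shift_real {F : ℂ × ℂ → ℂ} {h : ℂ → ℂ} (hF : wfReal F)
    (hh : ContinuousAt h 0) (h0 : h 0 = 0) :
    wfReal (fun x : ℂ × ℂ => F (x.1 + h x.2, x.2)) := by
  obtain ⟨ε, hε, H⟩ := hF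
  have hc : ∀ᶠ t in 𝓝 (0:ℂ), ‖h t‖ < ε / 2 :=
    hh.norm.eventually (gt_mem_nhds (by simp [h0, hε]))
  obtain ⟨δ, hδ, hb⟩ := Metric.eventually_nhds_iff_ball.1 hc
  refine ⟨min δ (ε / 2), by positivity, ?_⟩
  intro z z' t hz hz' ht ht0 hti e e'
  rw [lt_min_iff] at hz hz' ht
  have hht := hb t (by simpa using ht.1)
  have := H (z + h t) (z' + h t) t ((norm_add_le _ _).trans_lt (by linarith))
    ((norm_add_le _ _).trans_lt (by linarith)) (by linarith) ht0 hti e e'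
  simpa using this

lemma wf_root (m : ℕ) : 1 ≤ m → ∀ F : ℂ × ℂ → ℂ, AnalyticAt ℂ F 0 →
    analyticOrderAt (fun z => F (z, 0)) 0 = m → wfReal F →
    ∃ g : ℂ → ℂ, AnalyticAt ℂ g 0 ∧ g 0 = 0 ∧ ∀ᶠ t in 𝓝 (0:ℂ), F (g t, t) = 0 := by
  induction m using Nat.strong_induction_on with
  | _ m IH =>
  intro hm F hF hord hreal
  have hslice : AnalyticAt ℂ (fun z => F (z, 0)) 0 := wf_slice hF
  obtain ⟨hlow, htop⟩ := (analyticOrderAt_eq_nat_iff_iteratedDeriv_eq_zero hslice).1 hord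
  -- Tschirnhaus shift
  obtain ⟨h, hh, h0, hh1⟩ := wf_ift (wf_partial hF (m - 1)) (hlow (m - 1) (by omega)) (by
    have e : iteratedDeriv m (fun z => F (z, 0)) = deriv (iteratedDeriv (m - 1) fun z => F (z, 0)) := by
      rw [← iteratedDeriv_succ]; congr 1; omega
    rw [e] at htop
    exact htop)
  simp only at hh1
  let Fs : ℂ × ℂ → ℂ := fun x => F (x.1 + h x.2, x.2)
  have hFs : AnalyticAt ℂ Fs 0 := wf_shift_analytic hF hh h0
  have hFsr : wfReal Fs := wf_shift_real hreal hh.continuousAt h0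
  have hFso : analyticOrderAt (fun z => Fs (z, 0)) 0 = m := by
    simpa [Fs, h0] using hord
  have hFsc : ∀ᶠ t in 𝓝 (0:ℂ), wfCoef Fs (m - 1) t = 0 := by
    filter_upwards [hh1] with t ht
    have := congrFun (iteratedDeriv_comp_add_const (m - 1) (fun z => F (z, t)) (h t)) 0
    simp only [wfCoef, Fs]
    rw [this]
    simp only [zero_add]
    rw [ht, zero_div]
  suffices hsuf : ∃ g : ℂ → ℂ, AnalyticAt ℂ g 0 ∧ g 0 = 0 ∧ ∀ᶠ t in 𝓝 (0:ℂ), Fs (g t, t) = 0 by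
    obtain ⟨g, hg, hg0, hgr⟩ := hsuf
    exact ⟨fun t => g t + h t, hg.add hh, by simp [hg0, h0], hgr⟩
  obtain ⟨S, n, b, H, hS, hn, hb, hb0, hH, hH0, hFeq⟩ := wf_normal hFs hFso hFsc
  rcases S.eq_empty_or_nonempty with rfl | hne
  · refine ⟨fun _ => 0, analyticAt_const, rfl, ?_⟩
    have ht : Tendsto (fun t : ℂ => ((0:ℂ), t)) (𝓝 0) (𝓝 0) := by
      have : Continuous (fun t : ℂ => ((0:ℂ), t)) := by fun_prop
      exact this.tendsto' _ _ rfl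
    filter_upwards [ht.eventually hFeq] with t ht
    rw [ht]
    simp [show m ≠ 0 by omega]
  obtain ⟨i, hi, hmin⟩ := S.exists_min_image (fun j => (n j : ℚ) / ((m - j : ℕ) : ℚ)) hne
  have hSm : ∀ j ∈ S, j < m := fun j hj => by have := hS j hj; omega
  have hle : ∀ j ∈ S, n i * (m - j) ≤ (m - i) * n j := by
    intro j hj
    have h1 := hmin j hj
    have p1 : (0:ℚ) < ((m - j : ℕ) : ℚ) := by
      have := hSm j hj
      exact_mod_cast (by omega : 0 < m - j)
    have p2 : (0:ℚ) < ((m - i : ℕ) : ℚ) := by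
      have := hSm i hi
      exact_mod_cast (by omega : 0 < m - i)
    rw [div_le_div_iff₀ p2 p1] at h1
    have h2 : n i * (m - j) ≤ n j * (m - i) := by exact_mod_cast h1
    rwa [mul_comm (m - i)]
  have hq : 1 ≤ m - i := by have := hSm i hi; omega
  have hdvd : (m - i) ∣ n i := by
    obtain ⟨f1, f2, f3, f4⟩ := wfQ_facts (n := n) (b := b) (p := n i) (q := m - i) hS hH0 hi
      (hb0 i hi) (mul_comm _ _)
    obtain ⟨w0, w1, hne, e0, e1⟩ := wf_poly_two f1 f2 f3 f4
    refine wf_integral (hn i hi) hq hSm hle hFeq hb hH ?_ hFsr hne e0 e1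
    intro hz; rw [hz] at f4; simp at f4
  obtain ⟨k, hk⟩ := hdvd
  have hk1 : 1 ≤ k := by
    rcases Nat.eq_zero_or_pos k with rfl | h
    · have := hn i hi; rw [hk] at this; simp at this
    · exact h
  have hle' : ∀ j ∈ S, k * (m - j) ≤ 1 * n j := by
    intro j hj
    have := hle j hj
    rw [hk, mul_assoc] at this
    rw [one_mul]
    exact Nat.le_of_mul_le_mul_left this (by omega)
  obtain ⟨f1, f2, f3, f4⟩ := wfQ_facts (n := n) (b := b) (p := k) (q := 1) hS hH0 hi
      (hb0 i hi) (by rw [one_mul, hk, mul_comm])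
  obtain ⟨w, -, -, hw, -⟩ := wf_poly_two f1 f2 f3 f4
  have hmult := wf_poly_mult f1 f2 f3 f4 w
  set Q := wfQ S n b H m k 1 with hQdef
  have hQ : Q ≠ 0 := by intro hz; rw [hz] at f4; simp at f4
  have hmult1 : 1 ≤ Q.rootMultiplicity w := (Polynomial.rootMultiplicity_pos hQ).2 hw
  let K : ℂ × ℂ → ℂ := fun x => wfScale S n b H m k 1 (x.1 + w, x.2)
  have hshift : Tendsto (fun x : ℂ × ℂ => (x.1 + w, x.2)) (𝓝 0) (𝓝 (w, 0)) := by
    have : Continuous (fun x : ℂ × ℂ => (x.1 + w, x.2)) := by fun_prop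
    exact this.tendsto' _ _ (by simp)
  have hK : AnalyticAt ℂ K 0 := by
    refine AnalyticAt.comp_of_eq (g := wfScale S n b H m k 1) (f := fun x : ℂ × ℂ => (x.1 + w, x.2))
      (wfScale_analytic hk1 le_rfl hb hH w)
      (AnalyticAt.prod (analyticAt_fst.add analyticAt_const) analyticAt_snd) (by simp)
  have hKeq : ∀ᶠ x : ℂ × ℂ in 𝓝 0, Fs ((x.1 + w) * x.2 ^ k, x.2) = x.2 ^ (k * m) * K x := by
    filter_upwards [hshift.eventually (wfScale_eq hk1 le_rfl hSm hle' hFeq w)] with x hx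
    simpa using hx
  have hKord : analyticOrderAt (fun z => K (z, 0)) 0 = (Q.rootMultiplicity w : ℕ∞) := by
    rw [← wf_poly_order hQ w]
    simp only [K, wfScale_zero hk1 le_rfl, hQdef]
  have hKreal : wfReal K := by
    obtain ⟨ε, hε, hr⟩ := hFsr
    have hsm : ∀ᶠ x : ℂ × ℂ in 𝓝 0, ‖(x.1 + w) * x.2 ^ k‖ < ε := by
      have c1 : Continuous (fun x : ℂ × ℂ => ‖(x.1 + w) * x.2 ^ k‖) := by fun_prop
      refine c1.continuousAt.eventually (gt_mem_nhds ?_)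
      simp [show k ≠ 0 by omega, hε]
    obtain ⟨δ, hδ, hball⟩ := Metric.eventually_nhds_iff_ball.1 (hKeq.and hsm)
    refine ⟨min δ ε, by positivity, ?_⟩
    intro z z' t hz hz' ht ht0 hti e e'
    rw [lt_min_iff] at hz hz' ht
    have key : ∀ y : ℂ, ‖y‖ < δ → K (y, t) = 0 →
        Fs ((y + w) * t ^ k, t) = 0 ∧ ‖(y + w) * t ^ k‖ < ε := by
      intro y hy hy0
      obtain ⟨a1, a2⟩ := hball (y, t) (by
        rw [mem_ball_zero_iff, Prod.norm_def]; exact max_lt hy ht.1)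
      refine ⟨?_, a2⟩
      simp only at a1
      rw [a1, hy0, mul_zero]
    obtain ⟨a1, a2⟩ := key z hz.1 e
    obtain ⟨b1, b2⟩ := key z' hz'.1 e'
    have := hr _ _ t a2 b2 ht.2 ht0 hti a1 b1
    have htr : t = ((t.re : ℝ) : ℂ) := Complex.ext rfl (by simpa using hti)
    have hre : t.re ≠ 0 := by
      intro h; apply ht0; rw [htr, h]; simp
    have e3 : (z + w) * t ^ k - (z' + w) * t ^ k = ((t.re ^ k : ℝ) : ℂ) * (z - z') := by
      push_cast; rw [← htr]; ring
    rw [e3, Complex.im_ofReal_mul] at this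
    exact (mul_eq_zero.1 this).resolve_left (pow_ne_zero _ hre)
  obtain ⟨g, hg, hg0, hgr⟩ := IH _ hmult hmult1 K hK hKord hKreal
  refine ⟨fun t => (g t + w) * t ^ k, (hg.add analyticAt_const).mul (analyticAt_id.pow k), ?_, ?_⟩
  · simp [show k ≠ 0 by omega]
  · have hgt : Tendsto (fun t : ℂ => (g t, t)) (𝓝 0) (𝓝 0) := by
      have : ContinuousAt (fun t : ℂ => (g t, t)) 0 := hg.continuousAt.prodMk continuousAt_id
      have h2 := this.tendsto
      rw [hg0] at h2
      exact h2
    filter_upwards [hgr, hgt.eventually hKeq] with t h1 h2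
    rw [h2, h1, mul_zero]

lemma wf_factor (m : ℕ) : ∀ F : ℂ × ℂ → ℂ, AnalyticAt ℂ F 0 →
    analyticOrderAt (fun z => F (z, 0)) 0 = m → wfReal F →
    ∃ (G : ℂ × ℂ → ℂ) (g : Fin m → ℂ → ℂ), AnalyticAt ℂ G 0 ∧ G 0 ≠ 0 ∧
      (∀ ν, AnalyticAt ℂ (g ν) 0 ∧ g ν 0 = 0) ∧
      ∀ᶠ x : ℂ × ℂ in 𝓝 0, F x = G x * ∏ ν, (x.1 - g ν x.2) := by
  induction m with
  | zero =>
    intro F hF hord _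
    refine ⟨F, Fin.elim0, hF, ?_, fun ν => ν.elim0, by simp⟩
    have h := (wf_slice (z := 0) (t := 0) hF).analyticOrderAt_eq_zero.1 (by simpa using hord)
    exact h
  | succ m ih =>
    intro F hF hord hreal
    obtain ⟨g, hg, hg0, hgr⟩ := wf_root (m + 1) (by omega) F hF hord hreal
    let Fs : ℂ × ℂ → ℂ := fun x => F (x.1 + g x.2, x.2)
    have hFs : AnalyticAt ℂ Fs 0 := wf_shift_analytic hF hg hg0
    obtain ⟨F1, hF1, hdiv⟩ := wf_div hFs
    have hz : ∀ᶠ x : ℂ × ℂ in 𝓝 0, Fs x = x.1 * F1 x := by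
      filter_upwards [hdiv, wf_snd hgr] with x hx h0
      rw [hx]
      simp [Fs, h0]
    let F2 : ℂ × ℂ → ℂ := fun x => F1 (x.1 + (-g x.2), x.2)
    have hF2 : AnalyticAt ℂ F2 0 := wf_shift_analytic (h := fun t => -g t) hF1 hg.neg (by simp [hg0])
    have ht : Tendsto (fun x : ℂ × ℂ => (x.1 - g x.2, x.2)) (𝓝 0) (𝓝 0) := by
      have h1 : ContinuousAt (fun x : ℂ × ℂ => g x.2) 0 :=
        ContinuousAt.comp (g := g) (f := fun x : ℂ × ℂ => x.2) (x := 0) hg.continuousAt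
          continuousAt_snd
      have h2 : ContinuousAt (fun x : ℂ × ℂ => (x.1 - g x.2, x.2)) 0 :=
        (continuousAt_fst.sub h1).prodMk continuousAt_snd
      have h3 := h2.tendsto
      have h4 : ((0 : ℂ × ℂ).1 - g (0 : ℂ × ℂ).2, (0 : ℂ × ℂ).2) = 0 := by simp [hg0]
      rw [h4] at h3
      exact h3
    have hFF : ∀ᶠ x : ℂ × ℂ in 𝓝 0, F x = (x.1 - g x.2) * F2 x := by
      filter_upwards [ht.eventually hz] with x hx
      simpa [Fs, F2, sub_eq_add_neg] using hx
    have hs2 : AnalyticAt ℂ (fun z => F2 (z, 0)) 0 := wf_slice hF2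
    have hord2 : analyticOrderAt (fun z => F2 (z, 0)) 0 = m := by
      have hev : (fun z => F (z, 0)) =ᶠ[𝓝 0] (id * fun z => F2 (z, 0)) := by
        filter_upwards [(wf_evslice hFF).self_of_nhds] with z hz
        simpa [hg0] using hz
      rw [analyticOrderAt_congr hev, analyticOrderAt_mul analyticAt_id hs2, analyticOrderAt_id,
        add_comm] at hord
      push_cast at hord
      exact (ENat.add_left_injective_of_ne_top (by simp : (1:ℕ∞) ≠ ⊤)) hord
    have hreal2 : wfReal F2 := by
      obtain ⟨ε, hε, hr⟩ := hreal
      obtain ⟨δ, hδ, hball⟩ := Metric.eventually_nhds_iff_ball.1 hFF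
      refine ⟨min δ ε, by positivity, ?_⟩
      intro z z' t hz hz' ht ht0 hti e e'
      rw [lt_min_iff] at hz hz' ht
      have key : ∀ y : ℂ, ‖y‖ < δ → F2 (y, t) = 0 → F (y, t) = 0 := by
        intro y hy hy0
        rw [hball (y, t) (by rw [mem_ball_zero_iff, Prod.norm_def]; exact max_lt hy ht.1), hy0,
          mul_zero]
      exact hr z z' t hz.2 hz'.2 ht.2 ht0 hti (key z hz.1 e) (key z' hz'.1 e')
    obtain ⟨G, gs, hG, hG0, hgs, hfin⟩ := ih F2 hF2 hord2 hreal2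
    refine ⟨G, Fin.cons g gs, hG, hG0, ?_, ?_⟩
    · intro ν
      refine Fin.cases ?_ (fun ν => ?_) ν
      · exact ⟨hg, hg0⟩
      · exact hgs ν
    · filter_upwards [hFF, hfin] with x h1 h2
      rw [h1, h2, Fin.prod_univ_succ]
      simp only [Fin.cons_zero, Fin.cons_succ]
      ring

/-- Weierstrass-type factorization with analytic roots. -/
theorem weierstrass_type_factorization
    (F : ℂ × ℂ → ℂ) (U : Set (ℂ × ℂ)) (hU : U ∈ nhds ((0 : ℂ), (0 : ℂ)))
    (hF : ∀ p ∈ U, AnalyticAt ℂ F p)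
    (h0 : F (0, 0) = 0)
    (hreal : ∀ z t : ℂ, (z, t) ∈ U → F (z, t) = 0 → t.im = 0 → z.im = 0) :
    ∃ m : ℕ, 1 ≤ m ∧
      ∃ (G : ℂ × ℂ → ℂ) (g : Fin m → ℂ → ℂ) (r : ℝ), 0 < r ∧
        (∀ p ∈ Metric.ball ((0 : ℂ), (0 : ℂ)) r, AnalyticAt ℂ G p) ∧
        G (0, 0) ≠ 0 ∧
        (∀ ν : Fin m, (∀ t ∈ Metric.ball (0 : ℂ) r, AnalyticAt ℂ (g ν) t) ∧ g ν 0 = 0) ∧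
        (∀ p ∈ Metric.ball ((0 : ℂ), (0 : ℂ)) r,
          F p = G p * ∏ ν : Fin m, (p.1 - g ν p.2)) := by
  have hF0 : AnalyticAt ℂ F 0 := hF 0 (mem_of_mem_nhds hU)
  have hs : AnalyticAt ℂ (fun z => F (z, 0)) 0 := wf_slice hF0
  obtain ⟨ε, hε, hball⟩ := Metric.mem_nhds_iff.1 hU
  have hmem : ∀ z t : ℂ, ‖z‖ < ε → ‖t‖ < ε → (z, t) ∈ U := by
    intro z t hz ht
    refine hball ?_
    rw [← ball_prod_same]
    exact ⟨by simpa using hz, by simpa using ht⟩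
  have hR : wfReal F := by
    refine ⟨ε, hε, fun z z' t hz hz' ht _ hti e e' => ?_⟩
    rw [Complex.sub_im, hreal z t (hmem z t hz ht) e hti, hreal z' t (hmem z' t hz' ht) e' hti,
      sub_zero]
  have htop : analyticOrderAt (fun z => F (z, 0)) 0 ≠ ⊤ := by
    intro h
    rw [analyticOrderAt_eq_top] at h
    have ht : Tendsto (fun r : ℝ => (r:ℂ) * Complex.I) (𝓝[>] 0) (𝓝 0) := by
      have : Continuous (fun r : ℝ => (r:ℂ) * Complex.I) := by fun_prop
      exact (this.tendsto' 0 0 (by simp)).mono_left nhdsWithin_le_nhds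
    obtain ⟨r, ⟨hr1, hr2⟩, hr⟩ := ((ht.eventually (h.and (Metric.ball_mem_nhds (0:ℂ) hε))).and
      self_mem_nhdsWithin).exists
    have := hreal _ 0 (hmem _ 0 (by simpa using hr2) (by simpa using hε)) hr1 rfl
    have hr : (0:ℝ) < r := hr
    simp at this
    exact hr.ne' this
  obtain ⟨m, hm⟩ := ENat.ne_top_iff_exists.1 htop
  have hm1 : 1 ≤ m := by
    by_contra hlt
    have hm0 : m = 0 := by omega
    rw [hm0] at hm
    exact (hs.analyticOrderAt_eq_zero.1 hm.symm) h0
  obtain ⟨G, g, hG, hG0, hg, hfin⟩ := wf_factor m F hF0 hm.symm hR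
  have hgev : ∀ᶠ t in 𝓝 (0:ℂ), ∀ ν, AnalyticAt ℂ (g ν) t := by
    rw [eventually_all]
    exact fun ν => (hg ν).1.eventually_analyticAt
  obtain ⟨r1, hr1, hb1⟩ := Metric.eventually_nhds_iff_ball.1 (hG.eventually_analyticAt.and hfin)
  obtain ⟨r2, hr2, hb2⟩ := Metric.eventually_nhds_iff_ball.1 hgev
  refine ⟨m, hm1, G, g, min r1 r2, by positivity, ?_, hG0, ?_, ?_⟩
  · intro p hp
    exact (hb1 p (Metric.ball_subset_ball (min_le_left _ _) hp)).1
  · intro ν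
    exact ⟨fun t ht => hb2 t (Metric.ball_subset_ball (min_le_right _ _) ht) ν, (hg ν).2⟩
  · intro p hp
    exact (hb1 p (Metric.ball_subset_ball (min_le_left _ _) hp)).2
end

section
/- Lifting of the degeneracy at quasimomentum zero. Let V be an even-index cosine potential and fix an integer n ≥ 1. Define v₀ := ∫₀¹ V(x) dx and μ_n := ∫₀¹ V(x) e^{−4πinx} dx (a real number since V is even), and assume μ_n ≠ 0. Then there exist ε₀ > 0, C > 0 and functions E₊, E₋ : (0, ε₀) → ℝ such that for every ε ∈ (0, ε₀): (i) for each sign ± there is a twice continuously differentiable, 1-periodic Φ± : ℝ → ℂ, not identically zero, with −Φ±″(x) + εV(x)Φ±(x) = E±(ε)Φ±(x) for all x; (ii) |E±(ε) − (2nπ)² − ε(v₀ ± μ_n)| ≤ Cε²; in particular E₊(ε) ≠ E₋(ε) for ε sufficiently small, i.e. the double eigenvalue (2nπ)² of −d²/dx² at quasimomentum k = 0 splits. -/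
open MeasureTheory Filter

def Adm (σ : ℝ) (f : ℝ → ℝ) : Prop :=
  Continuous f ∧ (∀ x, f (x + 1) = f x) ∧ ∀ x, f (-x) = σ * f x

noncomputable def II (w g : ℝ → ℝ) : ℝ := ∫ x in (0:ℝ)..1, w x * g x

noncomputable def UU (ω : ℝ) (f : ℝ → ℝ) (x : ℝ) : ℝ :=
  -(1 / ω) * (Real.sin (ω * x) * (∫ t in (0:ℝ)..x, Real.cos (ω * t) * f t)
    - Real.cos (ω * x) * (∫ t in (0:ℝ)..x, Real.sin (ω * t) * f t))

noncomputable def SS (ω : ℝ) (w g : ℝ → ℝ) (x : ℝ) : ℝ :=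
  UU ω (fun y => g y - 2 * II w g * w y) x
    - 2 * II w (UU ω (fun y => g y - 2 * II w g * w y)) * w x

/-- Data on the unperturbed eigenfunction. -/
structure Good (ω σ : ℝ) (w : ℝ → ℝ) : Prop where
  pos : 1 ≤ ω
  sgn : σ = 1 ∨ σ = -1
  cosper : ∀ x, Real.cos (ω * (x + 1)) = Real.cos (ω * x)
  sinper : ∀ x, Real.sin (ω * (x + 1)) = Real.sin (ω * x)
  cas : (w = (fun x => Real.cos (ω * x)) ∧ σ = 1) ∨ (w = (fun x => Real.sin (ω * x)) ∧ σ = -1)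
  half : II w w = 1 / 2

lemma II_sub {w g h : ℝ → ℝ} (hw : Continuous w) (hg : Continuous g) (hh : Continuous h) :
    II w (fun x => g x - h x) = II w g - II w h := by
  unfold II
  rw [← intervalIntegral.integral_sub]
  · simp only [mul_sub]
  · exact (hw.mul hg).intervalIntegrable _ _
  · exact (hw.mul hh).intervalIntegrable _ _

lemma II_add {w g h : ℝ → ℝ} (hw : Continuous w) (hg : Continuous g) (hh : Continuous h) :
    II w (fun x => g x + h x) = II w g + II w h := by
  unfold II
  rw [← intervalIntegral.integral_add]
  · simp only [mul_add]
  · exact (hw.mul hg).intervalIntegrable _ _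
  · exact (hw.mul hh).intervalIntegrable _ _

lemma II_smul (w g : ℝ → ℝ) (c : ℝ) :
    II w (fun x => c * g x) = c * II w g := by
  unfold II
  rw [← intervalIntegral.integral_const_mul]
  congr 1; ext x; ring

lemma II_bound {w g : ℝ → ℝ} {M : ℝ} (hw : ∀ x, |w x| ≤ 1) (hg : ∀ x ∈ Set.Icc (0:ℝ) 1, |g x| ≤ M) :
    |II w g| ≤ M := by
  have := intervalIntegral.norm_integral_le_of_norm_le_const (a := (0:ℝ)) (b := 1) (C := M)
    (f := fun x => w x * g x) (by
      intro x hx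
      rw [Set.uIoc_of_le zero_le_one] at hx
      have h2 := hg x ⟨hx.1.le, hx.2⟩
      rw [Real.norm_eq_abs, abs_mul]
      nlinarith [hw x, abs_nonneg (w x), abs_nonneg (g x)])
  simpa [II] using this

section
variable {ω σ : ℝ} {w : ℝ → ℝ}

lemma Good.adm (h : Good ω σ w) : Adm σ w := by
  rcases h.cas with ⟨h1, h2⟩ | ⟨h1, h2⟩
  · subst h1; subst h2
    exact ⟨by fun_prop, h.cosper, by intro x; simp⟩
  · subst h1; subst h2
    exact ⟨by fun_prop, h.sinper, by intro x; simp⟩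

lemma Good.le_one (h : Good ω σ w) (x : ℝ) : |w x| ≤ 1 := by
  rcases h.cas with ⟨h1, h2⟩ | ⟨h1, h2⟩
  · subst h1; exact Real.abs_cos_le_one _
  · subst h1; exact Real.abs_sin_le_one _

lemma Good.deriv2 (h : Good ω σ w) : ∃ D : ℝ → ℝ, (∀ x, HasDerivAt w (D x) x) ∧
    ∀ x, HasDerivAt D (-ω ^ 2 * w x) x := by
  have hl : ∀ x : ℝ, HasDerivAt (fun x => ω * x) ω x := fun x => by
    simpa using (hasDerivAt_id x).const_mul ω
  rcases h.cas with ⟨h1, h2⟩ | ⟨h1, h2⟩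
  · subst h1
    refine ⟨fun x => -Real.sin (ω * x) * ω, fun x => (hl x).cos, fun x => ?_⟩
    refine ((hl x).sin.neg.mul_const ω).congr_deriv ?_
    ring
  · subst h1
    refine ⟨fun x => Real.cos (ω * x) * ω, fun x => (hl x).sin, fun x => ?_⟩
    refine ((hl x).cos.mul_const ω).congr_deriv ?_
    ring

lemma int_zero_of_odd {g : ℝ → ℝ} (hper : ∀ x, g (x + 1) = g x) (hodd : ∀ x, g (-x) = - g x) :
    ∫ x in (0:ℝ)..1, g x = 0 := by
  have h1 := intervalIntegral.integral_comp_sub_left (a := (0:ℝ)) (b := 1) g 1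
  have h2 : ∀ x, g (1 - x) = - g x := fun x => by
    rw [← hodd, ← hper (-x)]; congr 1; ring
  simp only [h2, intervalIntegral.integral_neg, sub_self, sub_zero] at h1
  linarith

lemma Good.orth (h : Good ω σ w) {f : ℝ → ℝ} (hf : Adm σ f) (h0 : II w f = 0) :
    (∫ t in (0:ℝ)..1, Real.cos (ω * t) * f t) = 0 ∧
    (∫ t in (0:ℝ)..1, Real.sin (ω * t) * f t) = 0 := by
  rcases h.cas with ⟨h1, h2⟩ | ⟨h1, h2⟩
  · subst h1; subst h2
    refine ⟨h0, int_zero_of_odd ?_ ?_⟩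
    · intro x; rw [h.sinper, hf.2.1]
    · intro x; rw [hf.2.2]; simp
  · subst h1; subst h2
    refine ⟨int_zero_of_odd ?_ ?_, h0⟩
    · intro x; rw [h.cosper, hf.2.1]
    · intro x; rw [hf.2.2]; simp

lemma prim_per {g : ℝ → ℝ} (hc : Continuous g) (hper : ∀ x, g (x + 1) = g x)
    (h0 : ∫ t in (0:ℝ)..1, g t = 0) (x : ℝ) :
    ∫ t in (0:ℝ)..(x+1), g t = ∫ t in (0:ℝ)..x, g t := by
  have hp : Function.Periodic g 1 := hper
  have h1 := hp.intervalIntegral_add_eq x 0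
  rw [zero_add, h0] at h1
  rw [← intervalIntegral.integral_add_adjacent_intervals (hc.intervalIntegrable 0 x)
    (hc.intervalIntegrable x (x+1)), h1, add_zero]

lemma prim_par {g : ℝ → ℝ} {τ : ℝ} (hpar : ∀ x, g (-x) = τ * g x) (x : ℝ) :
    ∫ t in (0:ℝ)..(-x), g t = -τ * ∫ t in (0:ℝ)..x, g t := by
  have h1 := intervalIntegral.integral_comp_neg (a := 0) (b := x) g
  simp only [hpar, intervalIntegral.integral_const_mul, neg_zero] at h1
  rw [intervalIntegral.integral_symm, ← h1]; ring

lemma UU_deriv (hω : ω ≠ 0) {f : ℝ → ℝ} (hf : Continuous f) : ∃ D : ℝ → ℝ,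
    (∀ x, HasDerivAt (UU ω f) (D x) x) ∧ ∀ x, HasDerivAt D (-ω ^ 2 * UU ω f x - f x) x := by
  have hl : ∀ x : ℝ, HasDerivAt (fun x => ω * x) ω x := fun x => by
    simpa using (hasDerivAt_id x).const_mul ω
  have hA : ∀ x, HasDerivAt (fun x => ∫ t in (0:ℝ)..x, Real.cos (ω * t) * f t)
      (Real.cos (ω * x) * f x) x := fun x =>
    (Continuous.integral_hasStrictDerivAt (by fun_prop) 0 x).hasDerivAt
  have hB : ∀ x, HasDerivAt (fun x => ∫ t in (0:ℝ)..x, Real.sin (ω * t) * f t)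
      (Real.sin (ω * x) * f x) x := fun x =>
    (Continuous.integral_hasStrictDerivAt (by fun_prop) 0 x).hasDerivAt
  refine ⟨fun x => -(Real.cos (ω * x) * (∫ t in (0:ℝ)..x, Real.cos (ω * t) * f t)
    + Real.sin (ω * x) * (∫ t in (0:ℝ)..x, Real.sin (ω * t) * f t)), fun x => ?_, fun x => ?_⟩
  · have := (((hl x).sin.mul (hA x)).sub ((hl x).cos.mul (hB x))).const_mul (-(1/ω))
    refine this.congr_deriv ?_
    field_simp; ring
  · have := (((hl x).cos.mul (hA x)).add ((hl x).sin.mul (hB x))).neg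
    refine this.congr_deriv ?_
    unfold UU
    field_simp
    linear_combination (-f x) * Real.sin_sq_add_cos_sq (ω * x)

lemma Good.UU_adm (h : Good ω σ w) {f : ℝ → ℝ} (hf : Adm σ f) (h0 : II w f = 0) :
    Adm σ (UU ω f) := by
  have hω : ω ≠ 0 := by have := h.pos; positivity
  obtain ⟨D, hD, -⟩ := UU_deriv hω hf.1
  have hfc := hf.1
  obtain ⟨o1, o2⟩ := h.orth hf h0
  refine ⟨continuous_iff_continuousAt.2 fun x => (hD x).continuousAt, fun x => ?_, fun x => ?_⟩
  · unfold UU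
    rw [h.cosper, h.sinper, prim_per (by fun_prop) (fun x => by rw [h.cosper, hf.2.1]) o1,
      prim_per (by fun_prop) (fun x => by rw [h.sinper, hf.2.1]) o2]
  · unfold UU
    rw [prim_par (τ := σ), prim_par (τ := -σ)]
    · simp only [mul_neg, Real.sin_neg, Real.cos_neg]; ring
    · intro x; simp only [mul_neg, Real.sin_neg, hf.2.2]; ring
    · intro x; simp only [mul_neg, Real.cos_neg, hf.2.2]; ring

lemma abs_le_of_per {f : ℝ → ℝ} {M : ℝ} (hper : ∀ x, f (x + 1) = f x)
    (h : ∀ x ∈ Set.Icc (0:ℝ) 1, |f x| ≤ M) (x : ℝ) : |f x| ≤ M := by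
  have hp : Function.Periodic f 1 := hper
  obtain ⟨y, hy, hxy⟩ := hp.exists_mem_Ico₀ one_pos x
  rw [hxy]; exact h y ⟨hy.1, hy.2.le⟩

lemma Good.UU_bound (h : Good ω σ w) {f : ℝ → ℝ} {M : ℝ} (hM : ∀ x, |f x| ≤ M)
    (x : ℝ) (hx : x ∈ Set.Icc (0:ℝ) 1) : |UU ω f x| ≤ 2 * M := by
  have hM0 : 0 ≤ M := (abs_nonneg _).trans (hM 0)
  have key : ∀ c : ℝ → ℝ, (∀ x, |c x| ≤ 1) → |∫ t in (0:ℝ)..x, c t * f t| ≤ M := by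
    intro c hc
    have := intervalIntegral.norm_integral_le_of_norm_le_const (a := (0:ℝ)) (b := x) (C := M)
      (f := fun x => c x * f x) (by
        intro y _
        rw [Real.norm_eq_abs, abs_mul]
        nlinarith [hc y, hM y, abs_nonneg (c y), abs_nonneg (f y)])
    rw [Real.norm_eq_abs, sub_zero, abs_of_nonneg hx.1] at this
    nlinarith [hx.2]
  have kA := key (fun t => Real.cos (ω * t)) (fun _ => Real.abs_cos_le_one _)
  have kB := key (fun t => Real.sin (ω * t)) (fun _ => Real.abs_sin_le_one _)
  unfold UU
  set A := ∫ t in (0:ℝ)..x, Real.cos (ω * t) * f t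
  set B := ∫ t in (0:ℝ)..x, Real.sin (ω * t) * f t
  have hi : |-(1/ω)| ≤ 1 := by
    have := h.pos
    rw [abs_neg, abs_of_nonneg (by positivity), div_le_one (by positivity)]; exact this
  have h1 : |Real.sin (ω * x) * A - Real.cos (ω * x) * B| ≤ 2 * M := by
    refine (abs_sub _ _).trans ?_
    rw [abs_mul, abs_mul]
    nlinarith [Real.abs_sin_le_one (ω * x), Real.abs_cos_le_one (ω * x), abs_nonneg A, abs_nonneg B]
  rw [abs_mul]
  nlinarith [abs_nonneg (Real.sin (ω * x) * A - Real.cos (ω * x) * B)]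

lemma UU_sub {f g : ℝ → ℝ} (hf : Continuous f) (hg : Continuous g) :
    UU ω (fun x => f x - g x) = fun x => UU ω f x - UU ω g x := by
  ext x
  unfold UU
  simp only [mul_sub]
  rw [intervalIntegral.integral_sub, intervalIntegral.integral_sub]
  · ring
  all_goals exact Continuous.intervalIntegrable (by fun_prop) _ _

lemma Good.proj (h : Good ω σ w) {g : ℝ → ℝ} (hg : Adm σ g) :
    Adm σ (fun y => g y - 2 * II w g * w y) ∧ II w (fun y => g y - 2 * II w g * w y) = 0 := by
  have hw := h.adm
  have hgc := hg.1
  have hwc := hw.1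
  refine ⟨⟨by fun_prop, fun x => by simp only [hg.2.1, hw.2.1],
    fun x => by simp only [hg.2.2, hw.2.2]; ring⟩, ?_⟩
  rw [II_sub hwc hgc (by fun_prop), II_smul, h.half]; ring

lemma Good.SS_adm (h : Good ω σ w) {g : ℝ → ℝ} (hg : Adm σ g) :
    Adm σ (SS ω w g) ∧ II w (SS ω w g) = 0 := by
  obtain ⟨p1, p2⟩ := h.proj hg
  exact h.proj (h.UU_adm p1 p2)

lemma Good.SS_bound (h : Good ω σ w) {g : ℝ → ℝ} {M : ℝ} (hg : Adm σ g) (hM : ∀ x, |g x| ≤ M)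
    (x : ℝ) : |SS ω w g x| ≤ 18 * M := by
  refine abs_le_of_per (h.SS_adm hg).1.2.1 ?_ x
  intro x hx
  have hb1 := II_bound (g := g) h.le_one (fun x _ => hM x)
  have hb2 : ∀ x, |g x - 2 * II w g * w x| ≤ 3 * M := fun x => by
    refine (abs_sub _ _).trans ?_
    rw [abs_mul, abs_mul, abs_two]
    nlinarith [h.le_one x, hM x, abs_nonneg (II w g), abs_nonneg (w x)]
  have hb3 := h.UU_bound hb2
  have hb4 := II_bound h.le_one hb3
  unfold SS
  refine (abs_sub _ _).trans ?_
  rw [abs_mul, abs_mul, abs_two]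
  nlinarith [h.le_one x, hb3 x hx, abs_nonneg (II w (UU ω (fun y => g y - 2 * II w g * w y))), abs_nonneg (w x)]

lemma Good.SS_sub (h : Good ω σ w) {f g : ℝ → ℝ} (hf : Adm σ f) (hg : Adm σ g) (x : ℝ) :
    SS ω w (fun x => f x - g x) x = SS ω w f x - SS ω w g x := by
  have hw := h.adm
  have hwc := hw.1
  have hfc := hf.1
  have hgc := hg.1
  have e : (fun y => f y - g y - 2 * II w (fun x => f x - g x) * w y) =
    fun y => (f y - 2 * II w f * w y) - (g y - 2 * II w g * w y) := by
    ext y; rw [II_sub hwc hfc hgc]; ring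
  have e2 := UU_sub (ω := ω) (f := fun y => f y - 2 * II w f * w y)
    (g := fun y => g y - 2 * II w g * w y) (by fun_prop) (by fun_prop)
  unfold SS
  rw [e, e2, II_sub hwc]
  · ring
  · exact (h.UU_adm (h.proj hf).1 (h.proj hf).2).1
  · exact (h.UU_adm (h.proj hg).1 (h.proj hg).2).1

lemma Good.SS_deriv (h : Good ω σ w) {g : ℝ → ℝ} (hg : Adm σ g) : ∃ D : ℝ → ℝ,
    (∀ x, HasDerivAt (SS ω w g) (D x) x) ∧
    ∀ x, HasDerivAt D (-ω ^ 2 * SS ω w g x - g x + 2 * II w g * w x) x := by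
  have hω : ω ≠ 0 := by have := h.pos; positivity
  obtain ⟨D, hD, hD2⟩ := UU_deriv hω (h.proj hg).1.1
  obtain ⟨F, hF, hF2⟩ := h.deriv2
  refine ⟨fun x => D x - 2 * II w (UU ω (fun y => g y - 2 * II w g * w y)) * F x,
    fun x => (hD x).sub ((hF x).const_mul _), fun x => ?_⟩
  refine ((hD2 x).sub ((hF2 x).const_mul _)).congr_deriv ?_
  unfold SS; ring
end

noncomputable def HH (V w ψ : ℝ → ℝ) (x : ℝ) : ℝ :=
  -(V x * (w x + ψ x)) + 2 * II w (fun y => V y * (w y + ψ y)) * ψ x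

section
variable {ω σ : ℝ} {w V : ℝ → ℝ}

lemma HH_adm (hV : Adm 1 V) (h : Good ω σ w) {ψ : ℝ → ℝ} (hψ : Adm σ ψ) : Adm σ (HH V w ψ) := by
  have hw := h.adm
  have := hV.1
  have := hw.1
  have := hψ.1
  refine ⟨by unfold HH; fun_prop, fun x => ?_, fun x => ?_⟩
  · simp only [HH, hV.2.1, hw.2.1, hψ.2.1]
  · simp only [HH, hV.2.2, hw.2.2, hψ.2.2]; ring

lemma HH_bound (h : Good ω σ w) {W : ℝ} (hW : ∀ x, |V x| ≤ W)
    {ψ : ℝ → ℝ} (hψ1 : ∀ x, |ψ x| ≤ 1) (x : ℝ) :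
    |HH V w ψ x| ≤ 7 * W := by
  have hW0 : 0 ≤ W := (abs_nonneg _).trans (hW 0)
  have h1 : ∀ x, |V x * (w x + ψ x)| ≤ 2 * W := fun x => by
    rw [abs_mul]
    have := (abs_add_le (w x) (ψ x)).trans (add_le_add (h.le_one x) (hψ1 x))
    nlinarith [hW x, abs_nonneg (V x), abs_nonneg (w x + ψ x)]
  have h2 := II_bound (w := w) h.le_one (fun x _ => h1 x)
  have b1 : |2 * II w (fun y => V y * (w y + ψ y)) * ψ x| ≤ 4 * W * 1 := by
    rw [abs_mul, abs_mul, abs_two]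
    exact mul_le_mul (by linarith) (hψ1 x) (abs_nonneg _) (by positivity)
  unfold HH
  refine (abs_add_le _ _).trans ?_
  rw [abs_neg]
  linarith [h1 x]

lemma HH_lip (hV : Adm 1 V) (h : Good ω σ w) {W : ℝ} (hW : ∀ x, |V x| ≤ W)
    {ψ φ : ℝ → ℝ} (cψ : Continuous ψ) (cφ : Continuous φ)
    (hψ1 : ∀ x, |ψ x| ≤ 1) (hφ1 : ∀ x, |φ x| ≤ 1) {d : ℝ}
    (hd : ∀ x, |ψ x - φ x| ≤ d) (x : ℝ) :
    |HH V w ψ x - HH V w φ x| ≤ 7 * W * d := by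
  have hW0 : 0 ≤ W := (abs_nonneg _).trans (hW 0)
  have hd0 : 0 ≤ d := (abs_nonneg _).trans (hd 0)
  have := hV.1
  have hwc := h.adm.1
  have h1 : ∀ x, |V x * (w x + ψ x)| ≤ 2 * W := fun x => by
    rw [abs_mul]
    have := (abs_add_le (w x) (ψ x)).trans (add_le_add (h.le_one x) (hψ1 x))
    nlinarith [hW x, abs_nonneg (V x), abs_nonneg (w x + ψ x)]
  have h2 := II_bound (w := w) h.le_one (fun x _ => h1 x)
  have h3 : ∀ x, |V x * (ψ x - φ x)| ≤ W * d := fun x => by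
    rw [abs_mul]
    exact mul_le_mul (hW x) (hd x) (abs_nonneg _) hW0
  have h4 := II_bound (w := w) h.le_one (fun x _ => h3 x)
  have e : II w (fun y => V y * (ψ y - φ y)) =
      II w (fun y => V y * (w y + ψ y)) - II w (fun y => V y * (w y + φ y)) := by
    rw [← II_sub hwc (by fun_prop) (by fun_prop)]
    congr 1; ext y; ring
  have e2 : HH V w ψ x - HH V w φ x = -(V x * (ψ x - φ x))
      + (2 * II w (fun y => V y * (w y + ψ y)) * (ψ x - φ x)
      + 2 * II w (fun y => V y * (ψ y - φ y)) * φ x) := by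
    rw [e]; unfold HH; ring
  rw [e2]
  have b1 : |2 * II w (fun y => V y * (w y + ψ y)) * (ψ x - φ x)| ≤ 4 * W * d := by
    rw [abs_mul, abs_mul, abs_two]
    exact mul_le_mul (by linarith) (hd x) (abs_nonneg _) (by positivity)
  have b2 : |2 * II w (fun y => V y * (ψ y - φ y)) * φ x| ≤ 2 * (W * d) * 1 := by
    rw [abs_mul, abs_mul, abs_two]
    exact mul_le_mul (by linarith) (hφ1 x) (abs_nonneg _) (by positivity)
  refine (abs_add_le _ _).trans ?_
  have b3 := abs_add_le (2 * II w (fun y => V y * (w y + ψ y)) * (ψ x - φ x))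
    (2 * II w (fun y => V y * (ψ y - φ y)) * φ x)
  rw [abs_neg]
  linarith [h3 x]

open BoundedContinuousFunction in
lemma exists_fixed (hV : Adm 1 V) (h : Good ω σ w) {W : ℝ} (hW : ∀ x, |V x| ≤ W)
    {ε : ℝ} (hε : 0 ≤ ε) (hε1 : ε * (126 * W) ≤ 1 / 2) :
    ∃ ψ : ℝ → ℝ, Adm σ ψ ∧ (∀ x, |ψ x| ≤ ε * (126 * W)) ∧
      ∀ x, ψ x = ε * SS ω w (HH V w ψ) x := by
  let s : Set (ℝ →ᵇ ℝ) := {ψ | (∀ x, ψ (x + 1) = ψ x) ∧ (∀ x, ψ (-x) = σ * ψ x) ∧ ∀ x, |ψ x| ≤ 1}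
  have ev : ∀ x : ℝ, Continuous fun ψ : ℝ →ᵇ ℝ => ψ x := fun x =>
    by fun_prop
  have hs : IsClosed s := by
    have e : s = (⋂ x, {ψ : ℝ →ᵇ ℝ | ψ (x + 1) = ψ x}) ∩
        ((⋂ x, {ψ : ℝ →ᵇ ℝ | ψ (-x) = σ * ψ x}) ∩ ⋂ x, {ψ : ℝ →ᵇ ℝ | |ψ x| ≤ 1}) := by
      ext ψ; simp [s]
    rw [e]
    refine (isClosed_iInter fun x => isClosed_eq (ev _) (ev _)).inter
      ((isClosed_iInter fun x => isClosed_eq (ev _) (continuous_const.mul (ev _))).inter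
      (isClosed_iInter fun x => isClosed_le (ev _).abs continuous_const))
  have : CompleteSpace s := hs.completeSpace_coe
  have : Nonempty s := ⟨⟨0, by simp [s]⟩⟩
  have sadm : ∀ ψ : s, Adm σ (ψ : ℝ →ᵇ ℝ) := fun ψ => ⟨ψ.1.continuous, ψ.2.1, ψ.2.2.1⟩
  have bd : ∀ (ψ : s) x, |ε * SS ω w (HH V w ψ.1) x| ≤ ε * (126 * W) := fun ψ x => by
    have := h.SS_bound (HH_adm hV h (sadm ψ)) (HH_bound h hW ψ.2.2.2) x
    rw [abs_mul, abs_of_nonneg hε]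
    exact mul_le_mul_of_nonneg_left (by linarith) hε
  have tadm : ∀ ψ : s, Adm σ (SS ω w (HH V w ψ.1)) := fun ψ => (h.SS_adm (HH_adm hV h (sadm ψ))).1
  let T : s → s := fun ψ => ⟨BoundedContinuousFunction.ofNormedAddCommGroup
    (fun x => ε * SS ω w (HH V w ψ.1) x) (continuous_const.mul (tadm ψ).1) (ε * (126 * W)) (bd ψ),
    fun x => by simp [(tadm ψ).2.1], fun x => by simp [(tadm ψ).2.2]; ring,
    fun x => (bd ψ x).trans (by linarith)⟩
  have hT : ∀ ψ x, (T ψ).1 x = ε * SS ω w (HH V w ψ.1) x := fun ψ x => rfl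
  have hc : ContractingWith (1 / 2) T := by
    refine ⟨by
      rw [← NNReal.coe_lt_coe]; norm_num, LipschitzWith.of_dist_le_mul fun ψ φ => ?_⟩
    rw [Subtype.dist_eq, Subtype.dist_eq, BoundedContinuousFunction.dist_le (by positivity)]
    intro x
    have hd : ∀ x, |ψ.1 x - φ.1 x| ≤ dist ψ.1 φ.1 := fun x => by
      rw [← Real.dist_eq]; exact BoundedContinuousFunction.dist_coe_le_dist x
    have hl := HH_lip hV h hW ψ.1.continuous φ.1.continuous ψ.2.2.2 φ.2.2.2 hd
    have a1 := HH_adm hV h (sadm ψ)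
    have a2 := HH_adm hV h (sadm φ)
    have a3 : Adm σ (fun x => HH V w ψ.1 x - HH V w φ.1 x) :=
      ⟨a1.1.sub a2.1, fun x => by simp only [a1.2.1, a2.2.1],
        fun x => by simp only [a1.2.2, a2.2.2]; ring⟩
    have hb := h.SS_bound a3 hl x
    rw [h.SS_sub a1 a2] at hb
    rw [Real.dist_eq, hT, hT, ← mul_sub, abs_mul, abs_of_nonneg hε]
    have hd0 : 0 ≤ dist ψ.1 φ.1 := dist_nonneg
    calc _ ≤ ε * (18 * (7 * W * dist ψ.1 φ.1)) := mul_le_mul_of_nonneg_left hb hε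
      _ = (ε * (126 * W)) * dist ψ.1 φ.1 := by ring
      _ ≤ 1 / 2 * dist ψ.1 φ.1 := mul_le_mul_of_nonneg_right hε1 hd0
      _ = _ := by simp
  have hfix := hc.fixedPoint_isFixedPt
  set ψ := ContractingWith.fixedPoint T hc
  have hfx : ∀ x, ψ.1 x = ε * SS ω w (HH V w ψ.1) x := fun x => by
    rw [← hT, hfix]
  exact ⟨ψ.1, sadm ψ, fun x => by rw [hfx]; exact bd ψ x, hfx⟩

lemma branch (hV : Adm 1 V) (h : Good ω σ w) {W : ℝ} (hW : ∀ x, |V x| ≤ W)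
    {ε : ℝ} (hε : 0 ≤ ε) (hε1 : ε * (126 * W) ≤ 1 / 2) :
    ∃ E : ℝ, (∃ Φ : ℝ → ℂ, ContDiff ℝ 2 Φ ∧ Φ ≠ 0 ∧ (∀ x, Φ (x + 1) = Φ x) ∧
          (∀ x, -(deriv (deriv Φ) x) + (ε : ℂ) * (V x : ℂ) * Φ x = (E : ℂ) * Φ x)) ∧
      |E - ω ^ 2 - ε * (2 * II w (fun x => V x * w x))| ≤ (252 * W ^ 2) * ε ^ 2 := by
  obtain ⟨ψ, ha, hb, hf⟩ := exists_fixed hV h hW hε hε1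
  have hW0 : 0 ≤ W := (abs_nonneg _).trans (hW 0)
  have hwc := h.adm.1
  have hVc := hV.1
  have hψc := ha.1
  have hH := HH_adm hV h ha
  have hI0 : II w ψ = 0 := by
    have : ψ = fun x => ε * SS ω w (HH V w ψ) x := funext hf
    calc II w ψ = II w (fun x => ε * SS ω w (HH V w ψ) x) := congrArg (II w) this
      _ = 0 := by rw [II_smul, (h.SS_adm hH).2, mul_zero]
  set d := 2 * II w (fun y => V y * (w y + ψ y)) with hd
  have hIH : 2 * II w (HH V w ψ) = - d := by
    have e : HH V w ψ = fun x => d * ψ x - V x * (w x + ψ x) := by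
      ext x; unfold HH; ring
    rw [e, II_sub hwc (by fun_prop) (by fun_prop), II_smul, hI0, hd]; ring
  obtain ⟨D, hD, hD2⟩ := h.SS_deriv hH
  obtain ⟨F, hF, hF2⟩ := h.deriv2
  have k1 : ∀ x, HasDerivAt (fun x => w x + ψ x) (F x + ε * D x) x := fun x => by
    have e : ψ = fun x => ε * SS ω w (HH V w ψ) x := funext hf
    have := (hF x).add ((hD x).const_mul ε)
    rw [show (fun x => w x + ψ x) = fun x => w x + ε * SS ω w (HH V w ψ) x from
      funext fun x => by rw [← hf]]
    exact this
  have k2 : ∀ x, HasDerivAt (fun x => F x + ε * D x)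
      ((ε * V x - (ω ^ 2 + ε * d)) * (w x + ψ x)) x := fun x => by
    refine ((hF2 x).add ((hD2 x).const_mul ε)).congr_deriv ?_
    rw [hIH]
    have e : HH V w ψ x = d * ψ x - V x * (w x + ψ x) := by unfold HH; ring
    rw [e]
    linear_combination (ω ^ 2) * hf x
  have c1 : ∀ x, HasDerivAt (fun x => ((w x + ψ x : ℝ) : ℂ)) ((F x + ε * D x : ℝ) : ℂ) x :=
    fun x => (k1 x).ofReal_comp
  have c2 : ∀ x, HasDerivAt (fun x => ((F x + ε * D x : ℝ) : ℂ))
      (((ε * V x - (ω ^ 2 + ε * d)) * (w x + ψ x) : ℝ) : ℂ) x :=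
    fun x => (k2 x).ofReal_comp
  have d1 : deriv (fun x => ((w x + ψ x : ℝ) : ℂ)) = fun x => ((F x + ε * D x : ℝ) : ℂ) :=
    funext fun x => (c1 x).deriv
  have d2 : deriv (fun x => ((F x + ε * D x : ℝ) : ℂ)) =
      fun x => (((ε * V x - (ω ^ 2 + ε * d)) * (w x + ψ x) : ℝ) : ℂ) :=
    funext fun x => (c2 x).deriv
  refine ⟨ω ^ 2 + ε * d, ⟨fun x => ((w x + ψ x : ℝ) : ℂ), ?_, ?_, ?_, ?_⟩, ?_⟩
  · rw [show (2 : WithTop ℕ∞) = 1 + 1 by norm_num, contDiff_succ_iff_deriv]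
    refine ⟨fun x => (c1 x).differentiableAt, by simp, ?_⟩
    rw [d1, contDiff_one_iff_deriv]
    refine ⟨fun x => (c2 x).differentiableAt, ?_⟩
    rw [d2]
    exact Complex.continuous_ofReal.comp (by fun_prop)
  · intro h0
    have hz : ∀ x, w x + ψ x = 0 := fun x => by
      have : ((w x + ψ x : ℝ) : ℂ) = 0 := congrFun h0 x
      exact_mod_cast this
    have h1 := II_add hwc hwc hψc
    rw [h.half, hI0] at h1
    simp only [hz] at h1
    simp [II] at h1
  · intro x
    simp only [h.adm.2.1, ha.2.1]
  · intro x
    rw [d1, d2]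
    push_cast; ring
  · have e : II w (fun y => V y * (w y + ψ y)) =
        II w (fun y => V y * w y) + II w (fun y => V y * ψ y) := by
      rw [← II_add hwc (by fun_prop) (by fun_prop)]
      congr 1; ext y; ring
    have e2 : ω ^ 2 + ε * d - ω ^ 2 - ε * (2 * II w (fun x => V x * w x))
        = ε * (2 * II w (fun y => V y * ψ y)) := by
      rw [hd, e]; ring
    have b := II_bound (w := w) (g := fun y => V y * ψ y) (M := W * (ε * (126 * W))) h.le_one
      (fun x _ => by
        rw [abs_mul]; exact mul_le_mul (hW x) (hb x) (abs_nonneg _) hW0)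
    rw [e2, abs_mul, abs_mul, abs_two, abs_of_nonneg hε]
    calc _ ≤ ε * (2 * (W * (ε * (126 * W)))) := by gcongr
      _ = _ := by ring
end

lemma int_cos_two (n : ℕ) (hn : 1 ≤ n) :
    ∫ x in (0:ℝ)..1, Real.cos (2 * ((2 * n * Real.pi) * x)) = 0 := by
  have hn' : (n : ℝ) ≠ 0 := by positivity
  have hp := Real.pi_ne_zero
  have hd : ∀ x : ℝ, HasDerivAt (fun x => Real.sin (2 * ((2 * n * Real.pi) * x)) / (4 * n * Real.pi))
      (Real.cos (2 * ((2 * n * Real.pi) * x))) x := fun x => by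
    have hl : HasDerivAt (fun x : ℝ => 2 * ((2 * n * Real.pi) * x)) (2 * ((2 * n * Real.pi))) x := by
      simpa using ((hasDerivAt_id x).const_mul (2 * n * Real.pi)).const_mul 2
    refine (hl.sin.div_const _).congr_deriv ?_
    field_simp; ring
  rw [intervalIntegral.integral_eq_sub_of_hasDerivAt (fun x _ => hd x)
    (Continuous.intervalIntegrable (by fun_prop) _ _)]
  have : Real.sin (2 * ((2 * n * Real.pi) * 1)) = 0 := by
    rw [show 2 * ((2 * n * Real.pi) * 1) = ((4 * n : ℕ) : ℝ) * Real.pi by push_cast; ring]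
    exact Real.sin_nat_mul_pi _
  rw [this]; simp

lemma good_omega (n : ℕ) (hn : 1 ≤ n) : 1 ≤ 2 * (n : ℝ) * Real.pi := by
  have : (1 : ℝ) ≤ n := by exact_mod_cast hn
  nlinarith [Real.pi_gt_three]

lemma cos_per (n : ℕ) (x : ℝ) :
    Real.cos (2 * (n : ℝ) * Real.pi * (x + 1)) = Real.cos (2 * (n : ℝ) * Real.pi * x) := by
  rw [show 2 * (n : ℝ) * Real.pi * (x + 1) = 2 * (n : ℝ) * Real.pi * x + n * (2 * Real.pi) by ring]
  exact Real.cos_add_nat_mul_two_pi _ _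

lemma sin_per (n : ℕ) (x : ℝ) :
    Real.sin (2 * (n : ℝ) * Real.pi * (x + 1)) = Real.sin (2 * (n : ℝ) * Real.pi * x) := by
  rw [show 2 * (n : ℝ) * Real.pi * (x + 1) = 2 * (n : ℝ) * Real.pi * x + n * (2 * Real.pi) by ring]
  exact Real.sin_add_nat_mul_two_pi _ _

lemma II_cos (V : ℝ → ℝ) (hV : Continuous V) (ω : ℝ) :
    2 * II (fun x => Real.cos (ω * x)) (fun x => V x * Real.cos (ω * x)) =
      (∫ x in (0:ℝ)..1, V x) + ∫ x in (0:ℝ)..1, V x * Real.cos (2 * (ω * x)) := by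
  unfold II
  rw [← intervalIntegral.integral_add (hV.intervalIntegrable _ _)
    (Continuous.intervalIntegrable (by fun_prop) _ _), ← intervalIntegral.integral_const_mul]
  congr 1; ext x
  rw [Real.cos_two_mul]; ring

lemma II_sin (V : ℝ → ℝ) (hV : Continuous V) (ω : ℝ) :
    2 * II (fun x => Real.sin (ω * x)) (fun x => V x * Real.sin (ω * x)) =
      (∫ x in (0:ℝ)..1, V x) - ∫ x in (0:ℝ)..1, V x * Real.cos (2 * (ω * x)) := by
  unfold II
  rw [← intervalIntegral.integral_sub (hV.intervalIntegrable _ _)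
    (Continuous.intervalIntegrable (by fun_prop) _ _), ← intervalIntegral.integral_const_mul]
  congr 1; ext x
  rw [Real.cos_two_mul]; linear_combination (2 * V x) * Real.sin_sq_add_cos_sq (ω * x)

lemma good_cos (n : ℕ) (hn : 1 ≤ n) :
    Good (2 * (n : ℝ) * Real.pi) 1 (fun x => Real.cos (2 * (n : ℝ) * Real.pi * x)) where
  pos := good_omega n hn
  sgn := Or.inl rfl
  cosper := cos_per n
  sinper := sin_per n
  cas := Or.inl ⟨rfl, rfl⟩
  half := by
    have := II_cos (fun _ => 1) continuous_const (2 * (n : ℝ) * Real.pi)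
    simp only [one_mul, int_cos_two n hn] at this
    norm_num at this
    linarith

lemma good_sin (n : ℕ) (hn : 1 ≤ n) :
    Good (2 * (n : ℝ) * Real.pi) (-1) (fun x => Real.sin (2 * (n : ℝ) * Real.pi * x)) where
  pos := good_omega n hn
  sgn := Or.inr rfl
  cosper := cos_per n
  sinper := sin_per n
  cas := Or.inr ⟨rfl, rfl⟩
  half := by
    have := II_sin (fun _ => 1) continuous_const (2 * (n : ℝ) * Real.pi)
    simp only [one_mul, int_cos_two n hn] at this
    norm_num at this
    linarith

lemma mu_real (V : ℝ → ℝ) (hV : Continuous V) (n : ℕ) (μn : ℝ)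
    (hμn : (μn : ℂ) = ∫ x in (0:ℝ)..1,
        (V x : ℂ) * Complex.exp (-(4 * (Real.pi : ℂ) * Complex.I * (n : ℂ) * (x : ℂ)))) :
    μn = ∫ x in (0:ℝ)..1, V x * Real.cos (2 * (2 * (n : ℝ) * Real.pi * x)) := by
  have h1 := congrArg Complex.reCLM hμn
  rw [← ContinuousLinearMap.intervalIntegral_comp_comm _
    (Continuous.intervalIntegrable (by fun_prop) _ _)] at h1
  simp only [Complex.reCLM_apply, Complex.ofReal_re] at h1
  rw [h1]
  congr 1; ext x
  rw [Complex.re_ofReal_mul, show (-(4 * (Real.pi : ℂ) * Complex.I * (n : ℂ) * (x : ℂ)))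
    = ((-(2 * (2 * (n : ℝ) * Real.pi * x)) : ℝ) : ℂ) * Complex.I by push_cast; ring,
    Complex.exp_ofReal_mul_I_re, Real.cos_neg]

/-- Lifting of the degeneracy at quasimomentum zero. -/
theorem degeneracy_lifting_at_zero
    (V : ℝ → ℝ) (hV : ContDiff ℝ (⊤ : ℕ∞) V) (hVeven : ∀ x, V (-x) = V x)
    (hVhalf : ∀ x, V (x + 1/2) = V x)
    (n : ℕ) (hn : 1 ≤ n)
    (v0 μn : ℝ)
    (hv0 : v0 = ∫ x in (0:ℝ)..1, V x)
    (hμn : (μn : ℂ) = ∫ x in (0:ℝ)..1,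
        (V x : ℂ) * Complex.exp (-(4 * (Real.pi : ℂ) * Complex.I * (n : ℂ) * (x : ℂ))))
    (hμnne : μn ≠ 0) :
    ∃ ε₀ > (0:ℝ), ∃ C > (0:ℝ), ∃ Ep Em : ℝ → ℝ,
      (∀ ε ∈ Set.Ioo (0:ℝ) ε₀,
        (∃ Φ : ℝ → ℂ, ContDiff ℝ 2 Φ ∧ Φ ≠ 0 ∧ (∀ x, Φ (x + 1) = Φ x) ∧
          (∀ x, -(deriv (deriv Φ) x) + (ε : ℂ) * (V x : ℂ) * Φ x = (Ep ε : ℂ) * Φ x)) ∧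
        (∃ Φ : ℝ → ℂ, ContDiff ℝ 2 Φ ∧ Φ ≠ 0 ∧ (∀ x, Φ (x + 1) = Φ x) ∧
          (∀ x, -(deriv (deriv Φ) x) + (ε : ℂ) * (V x : ℂ) * Φ x = (Em ε : ℂ) * Φ x)) ∧
        |Ep ε - (2 * (n : ℝ) * Real.pi) ^ 2 - ε * (v0 + μn)| ≤ C * ε ^ 2 ∧
        |Em ε - (2 * (n : ℝ) * Real.pi) ^ 2 - ε * (v0 - μn)| ≤ C * ε ^ 2) ∧
      (∃ ε₁ : ℝ, 0 < ε₁ ∧ ε₁ ≤ ε₀ ∧ ∀ ε ∈ Set.Ioo (0:ℝ) ε₁, Ep ε ≠ Em ε) := by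

  have hVc : Continuous V := hV.continuous
  have hVa : Adm 1 V := ⟨hVc, fun x => by
    rw [← hVhalf x, ← hVhalf (x + 1/2)]; congr 1; ring, fun x => by rw [hVeven, one_mul]⟩
  obtain ⟨W, hW1, hW⟩ : ∃ W : ℝ, 1 ≤ W ∧ ∀ x, |V x| ≤ W := by
    obtain ⟨W, hW⟩ := (isCompact_Icc (a := (0:ℝ)) (b := 1)).exists_bound_of_continuousOn
      hVc.continuousOn
    exact ⟨max W 1, le_max_right _ _, fun x => (abs_le_of_per hVa.2.1 hW x).trans (le_max_left _ _)⟩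
  have hμ := mu_real V hVc n μn hμn
  have hp := II_cos V hVc (2 * (n : ℝ) * Real.pi)
  have hm := II_sin V hVc (2 * (n : ℝ) * Real.pi)
  rw [← hμ, ← hv0] at hp hm
  have hW0 : 0 < W := by linarith
  have hsm : ∀ ε ∈ Set.Ioo (0:ℝ) (1 / (252 * W)), ε * (126 * W) ≤ 1 / 2 := fun ε he => by
    have := he.2
    rw [lt_div_iff₀ (by positivity)] at this
    linarith
  have HP := fun (ε : ℝ) (he : ε ∈ Set.Ioo (0:ℝ) (1 / (252 * W))) =>
    branch hVa (good_cos n hn) hW he.1.le (hsm ε he)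
  have HM := fun (ε : ℝ) (he : ε ∈ Set.Ioo (0:ℝ) (1 / (252 * W))) =>
    branch hVa (good_sin n hn) hW he.1.le (hsm ε he)
  rw [hp] at HP
  rw [hm] at HM
  choose! Ep hEp using HP
  choose! Em hEm using HM
  refine ⟨1 / (252 * W), by positivity, 252 * W ^ 2, by positivity, Ep, Em,
    fun ε he => ⟨(hEp ε he).1, (hEm ε he).1, (hEp ε he).2, (hEm ε he).2⟩,
    min (1 / (252 * W)) (|μn| / (252 * W ^ 2)), ?_, min_le_left _ _, ?_⟩
  · have := abs_pos.2 hμnne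
    positivity
  · intro ε he heq
    have he1 : ε ∈ Set.Ioo (0:ℝ) (1 / (252 * W)) := ⟨he.1, he.2.trans_le (min_le_left _ _)⟩
    have he2 := he.2.trans_le (min_le_right _ _)
    rw [lt_div_iff₀ (by positivity)] at he2
    have a := (hEp ε he1).2
    have b := (hEm ε he1).2
    rw [heq] at a
    have e : ε * (2 * μn) = (Em ε - (2 * (n : ℝ) * Real.pi) ^ 2 - ε * (v0 - μn))
      - (Em ε - (2 * (n : ℝ) * Real.pi) ^ 2 - ε * (v0 + μn)) := by ring
    have f := abs_sub (Em ε - (2 * (n : ℝ) * Real.pi) ^ 2 - ε * (v0 - μn))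
      (Em ε - (2 * (n : ℝ) * Real.pi) ^ 2 - ε * (v0 + μn))
    rw [← e, abs_mul, abs_mul, abs_two, abs_of_pos he.1] at f
    nlinarith [mul_lt_mul_of_pos_left he2 he.1]
end

section
/- Gap opening at a Dirac point due to breaking of inversion symmetry. Let V be an even-index cosine potential, W an odd-index cosine potential, let (E⋆, Φ₁) be Dirac point data for V, set Φ₂(x) := Φ₁(−x), λ♯ := 2i ∫₀¹ conj(Φ₁)Φ₁′ and θ♯ := ∫₀¹ conj(Φ₁)WΦ₂, and assume θ♯ ≠ 0. Fix κ∞ > 0. Then there exist δ₀ > 0 and C > 0 such that for all real δ with 0 < |δ| < δ₀ and all real k with |k − π| ≤ |δ|, there exist real numbers E_{δ,+}(k) and E_{δ,−}(k) and, for each sign ±, a twice continuously differentiable Φ : ℝ → ℂ, not identically zero, with −Φ″(x) + (V(x) + δκ∞W(x))Φ(x) = E_{δ,±}(k)Φ(x) for all x and Φ(x + 1) = e^{ik}Φ(x) for all x, such that | E_{δ,±}(k) − E⋆ ∓ √( δ²κ∞²θ♯² + (k − π)²λ♯² ) | ≤ Cδ². -/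
open MeasureTheory Filter

theorem gap_ode_exists {A : Type*} [NormedRing A] [NormedAlgebra ℝ A] [CompleteSpace A]
    (N : ℝ → A) (hN : Continuous N) (hb : ∀ x, ‖N x‖ ≤ 1/2) :
    ∃ Y : ℝ → A, Y 0 = 1 ∧ (∀ x, HasDerivAt Y (N x * Y x) x) ∧
      ∀ x, ‖Y x‖ ≤ 2 * ‖(1:A)‖ * Real.cosh x := by
  have hi : ∀ g : BoundedContinuousFunction ℝ A, Continuous fun t => N t * (Real.cosh t • g t) := by
    intro g
    exact hN.mul (Real.continuous_cosh.smul g.continuous)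
  have hbd : ∀ (g : BoundedContinuousFunction ℝ A) (x : ℝ),
      ‖∫ t in (0:ℝ)..x, N t * (Real.cosh t • g t)‖ ≤ 1/2 * ‖g‖ * Real.cosh x := by
    intro g x
    have h1 : ‖∫ t in (0:ℝ)..x, N t * (Real.cosh t • g t)‖ ≤
        |∫ t in (0:ℝ)..x, 1/2 * ‖g‖ * Real.cosh t| := by
      apply intervalIntegral.norm_integral_le_abs_of_norm_le
      · refine Eventually.of_forall fun t => ?_
        calc ‖N t * (Real.cosh t • g t)‖ ≤ ‖N t‖ * ‖Real.cosh t • g t‖ := norm_mul_le _ _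
          _ = ‖N t‖ * (Real.cosh t * ‖g t‖) := by
            rw [norm_smul, Real.norm_of_nonneg (Real.cosh_pos t).le]
          _ ≤ 1/2 * (Real.cosh t * ‖g‖) := by
            have := Real.cosh_pos t
            gcongr
            · exact hb t
            · exact g.norm_coe_le_norm t
          _ = _ := by ring
      · exact (Continuous.intervalIntegrable (by fun_prop) _ _)
    have h2 : ∫ t in (0:ℝ)..x, Real.cosh t = Real.sinh x := by
      rw [intervalIntegral.integral_eq_sub_of_hasDerivAt (f := Real.sinh)
        (fun t _ => Real.hasDerivAt_sinh t) (Real.continuous_cosh.intervalIntegrable _ _)]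
      simp
    rw [intervalIntegral.integral_const_mul, h2, abs_mul, abs_of_nonneg (by positivity)] at h1
    refine h1.trans ?_
    gcongr
    rw [Real.abs_sinh, ← Real.cosh_abs x]
    exact (Real.sinh_lt_cosh _).le
  have hcs : ∀ x : ℝ, ‖(Real.cosh x)⁻¹‖ ≤ 1 := fun x => by
    rw [norm_inv, Real.norm_of_nonneg (Real.cosh_pos x).le]
    exact inv_le_one_of_one_le₀ (Real.one_le_cosh x)
  have hcont : ∀ g : BoundedContinuousFunction ℝ A, Continuous fun x => (Real.cosh x)⁻¹ •
      ((1:A) + ∫ t in (0:ℝ)..x, N t * (Real.cosh t • g t)) := by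
    intro g
    refine (Real.continuous_cosh.inv₀ fun x => (Real.cosh_pos x).ne').smul
      (continuous_const.add ?_)
    exact intervalIntegral.continuous_primitive (fun a b => (hi g).intervalIntegrable a b) 0
  have hPb : ∀ (g : BoundedContinuousFunction ℝ A) (x : ℝ), ‖(Real.cosh x)⁻¹ •
      ((1:A) + ∫ t in (0:ℝ)..x, N t * (Real.cosh t • g t))‖ ≤ ‖(1:A)‖ + 1/2 * ‖g‖ := by
    intro g x
    have hc := Real.cosh_pos x
    rw [smul_add]
    refine (norm_add_le _ _).trans (add_le_add ?_ ?_)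
    · rw [norm_smul]
      have := hcs x
      have := norm_nonneg (1:A)
      nlinarith
    · rw [norm_smul, norm_inv, Real.norm_of_nonneg hc.le, inv_mul_le_iff₀ hc]
      linarith [hbd g x]
  let P : BoundedContinuousFunction ℝ A → BoundedContinuousFunction ℝ A := fun g =>
    BoundedContinuousFunction.ofNormedAddCommGroup _ (hcont g) _ (hPb g)
  have hPc : ContractingWith (1/2) P := by
    refine ⟨by rw [← NNReal.coe_lt_coe]; norm_num, LipschitzWith.of_dist_le_mul fun g h => ?_⟩
    rw [BoundedContinuousFunction.dist_le (by positivity)]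
    intro x
    have hc := Real.cosh_pos x
    have e : P g x - P h x = (Real.cosh x)⁻¹ •
        ∫ t in (0:ℝ)..x, N t * (Real.cosh t • (g - h) t) := by
      change (Real.cosh x)⁻¹ • ((1:A) + ∫ t in (0:ℝ)..x, N t * (Real.cosh t • g t)) -
        (Real.cosh x)⁻¹ • ((1:A) + ∫ t in (0:ℝ)..x, N t * (Real.cosh t • h t)) = _
      rw [← smul_sub, add_sub_add_left_eq_sub, ← intervalIntegral.integral_sub
        ((hi g).intervalIntegrable _ _) ((hi h).intervalIntegrable _ _)]
      simp [smul_sub, mul_sub]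
    rw [dist_eq_norm, e, norm_smul, norm_inv, Real.norm_of_nonneg hc.le, inv_mul_le_iff₀ hc,
      dist_eq_norm]
    have := hbd (g - h) x
    push_cast
    linarith
  obtain ⟨g, hg⟩ : ∃ g, P g = g := ⟨_, hPc.fixedPoint_isFixedPt⟩
  have hgx : ∀ x, Real.cosh x • g x = 1 + ∫ t in (0:ℝ)..x, N t * (Real.cosh t • g t) := by
    intro x
    have : g x = (Real.cosh x)⁻¹ • ((1:A) + ∫ t in (0:ℝ)..x, N t * (Real.cosh t • g t)) := by
      conv_lhs => rw [← hg]
      rfl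
    conv_lhs => rw [this]
    rw [smul_smul, mul_inv_cancel₀ (Real.cosh_pos x).ne', one_smul]
  have hgn : ‖g‖ ≤ 2 * ‖(1:A)‖ := by
    have : ‖P g‖ ≤ ‖(1:A)‖ + 1/2 * ‖g‖ :=
      BoundedContinuousFunction.norm_ofNormedAddCommGroup_le _ (by positivity) (hPb g)
    rw [hg] at this
    linarith
  refine ⟨fun x => Real.cosh x • g x, ?_, ?_, ?_⟩
  · change Real.cosh 0 • g 0 = 1
    rw [hgx]; simp
  · intro x
    have h1 : HasDerivAt (fun x => 1 + ∫ t in (0:ℝ)..x, N t * (Real.cosh t • g t))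
        (N x * (Real.cosh x • g x)) x :=
      (intervalIntegral.integral_hasDerivAt_right ((hi g).intervalIntegrable _ _)
        ((hi g).stronglyMeasurableAtFilter _ _) (hi g).continuousAt).const_add _
    have h2 : (fun x => Real.cosh x • g x) =
      (fun x => 1 + ∫ t in (0:ℝ)..x, N t * (Real.cosh t • g t)) := funext hgx
    change HasDerivAt _ (N x * (Real.cosh x • g x)) x
    rw [h2]; exact h1
  · intro x
    rw [norm_smul, Real.norm_of_nonneg (Real.cosh_pos x).le, mul_comm]
    have := Real.cosh_pos x
    gcongr
    exact (g.norm_coe_le_norm x).trans hgn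

theorem gap_ode_unique {A : Type*} [NormedRing A] [NormedAlgebra ℝ A]
    (N : ℝ → A) (K : ℝ) (hb : ∀ x, ‖N x‖ ≤ K) (Y Z : ℝ → A)
    (hY : ∀ x, HasDerivAt Y (N x * Y x) x) (hZ : ∀ x, HasDerivAt Z (N x * Z x) x)
    (h0 : Y 0 = Z 0) : Y = Z := by
  have hK : 0 ≤ K := (norm_nonneg _).trans (hb 0)
  refine ODE_solution_unique_univ (v := fun x y => N x * y) (K := ⟨K, hK⟩) (s := fun _ => Set.univ)
    (t₀ := 0) ?_ (fun t => ⟨hY t, trivial⟩) (fun t => ⟨hZ t, trivial⟩) h0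
  intro t
  refine (LipschitzWith.of_dist_le_mul fun a b => ?_).lipschitzOnWith
  rw [dist_eq_norm, dist_eq_norm, ← mul_sub]
  exact (norm_mul_le _ _).trans (mul_le_mul_of_nonneg_right (hb t) (norm_nonneg _))

theorem gap_cosh_le {x : ℝ} (h0 : 0 ≤ x) (h1 : x ≤ 1) : Real.cosh x ≤ 2 := by
  have h : Real.cosh x ≤ Real.cosh 1 := by
    rw [Real.cosh_le_cosh, abs_of_nonneg h0]; simpa using h1
  have h2 : Real.cosh 1 ≤ 2 := by
    rw [Real.cosh_eq]
    have := Real.exp_one_lt_d9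
    have : Real.exp (-1) ≤ 1 := Real.exp_le_one_iff.2 (by norm_num)
    linarith
  linarith

theorem gap_seg {A : Type*} [NormedAddCommGroup A] [NormedSpace ℝ A] (f f' : ℝ → A) (C : ℝ)
    (hf : ∀ x, HasDerivAt f (f' x) x) (h0 : f 0 = 0)
    (hb : ∀ x, 0 ≤ x → x ≤ 1 → ‖f' x‖ ≤ C) : ∀ x, 0 ≤ x → x ≤ 1 → ‖f x‖ ≤ C := by
  intro x hx hx1
  have := norm_image_sub_le_of_norm_deriv_le_segment' (a := 0) (b := 1)
    (fun x _ => (hf x).hasDerivWithinAt) (fun x hx => hb x hx.1 hx.2.le) x ⟨hx, hx1⟩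
  rw [h0, sub_zero, sub_zero] at this
  have hC : 0 ≤ C := (norm_nonneg _).trans (hb 0 le_rfl zero_le_one)
  nlinarith

theorem gap_expand {A : Type*} [NormedRing A] [NormedAlgebra ℝ A] [CompleteSpace A]
    (N : ℝ → A) (hN : Continuous N) (K : ℝ) (hb : ∀ x, ‖N x‖ ≤ K)
    (τ' : A → ℝ) (hadd : ∀ a b, τ' (a + b) = τ' a + τ' b)
    (hsmul : ∀ (c : ℝ) a, τ' (c • a) = c * τ' a) (T : ℝ) (hT0 : 0 ≤ T) (hT : ∀ a, |τ' a| ≤ T * ‖a‖)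
    (hτ' : ∀ a b, τ' (a * b) = τ' (b * a))
    (Y : ℝ → A) (hY0 : Y 0 = 1) (hY : ∀ x, HasDerivAt Y (N x * Y x) x)
    (hYb : ∀ x, ‖Y x‖ ≤ 2 * ‖(1:A)‖ * Real.cosh x) :
    |τ' (Y 1) - τ' 1 - τ' (∫ t in (0:ℝ)..1, N t) -
      1/2 * τ' ((∫ t in (0:ℝ)..1, N t) * (∫ t in (0:ℝ)..1, N t))| ≤
      T * (K * (K * (K * (4 * ‖(1:A)‖)))) := by
  obtain ⟨τ, hτe⟩ : ∃ τ : A →L[ℝ] ℝ, ∀ a, τ a = τ' a :=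
    ⟨LinearMap.mkContinuous
      { toFun := τ', map_add' := hadd, map_smul' := fun c a => by simp [hsmul] } T hT, fun _ => rfl⟩
  have hτ : ∀ a b, τ (a * b) = τ (b * a) := fun a b => by rw [hτe, hτe, hτ']
  have hK : 0 ≤ K := (norm_nonneg _).trans (hb 0)
  set F : ℝ → A := fun x => ∫ t in (0:ℝ)..x, N t with hF
  have hFd : ∀ x, HasDerivAt F (N x) x := fun x =>
    intervalIntegral.integral_hasDerivAt_right (hN.intervalIntegrable _ _)
        (hN.stronglyMeasurableAtFilter _ _) hN.continuousAt
  have hFc : Continuous F := continuous_iff_continuousAt.2 fun x => (hFd x).continuousAt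
  have hNF : Continuous fun t => N t * F t := hN.mul hFc
  set G : ℝ → A := fun x => ∫ t in (0:ℝ)..x, N t * F t with hG
  have hGd : ∀ x, HasDerivAt G (N x * F x) x := fun x =>
    intervalIntegral.integral_hasDerivAt_right (hNF.intervalIntegrable _ _)
        (hNF.stronglyMeasurableAtFilter _ _) hNF.continuousAt
  have hF0 : F 0 = 0 := by simp [hF]
  have hG0 : G 0 = 0 := by simp [hG]
  have hmul : ∀ (x : ℝ) (a : A) (C : ℝ), ‖a‖ ≤ C → ‖N x * a‖ ≤ K * C := fun x a C h =>
    (norm_mul_le _ _).trans (mul_le_mul (hb x) h (norm_nonneg _) hK)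
  have b0 : ∀ x, 0 ≤ x → x ≤ 1 → ‖Y x‖ ≤ 4 * ‖(1:A)‖ := by
    intro x h0 h1
    have := gap_cosh_le h0 h1
    have h3 := norm_nonneg (1:A)
    have := hYb x
    nlinarith
  have b1 := gap_seg (fun x => Y x - 1) (fun x => N x * Y x) _ (fun x => (hY x).sub_const 1)
    (by simp [hY0]) (fun x h0 h1 => hmul x _ _ (b0 x h0 h1))
  have b2 := gap_seg (fun x => Y x - 1 - F x) (fun x => N x * (Y x - 1)) _
    (fun x => by
      have := ((hY x).sub_const 1).sub (hFd x)
      rwa [show N x * Y x - N x = N x * (Y x - 1) by noncomm_ring] at this)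
    (by simp [hY0, hF0]) (fun x h0 h1 => hmul x _ _ (b1 x h0 h1))
  have b3 := gap_seg (fun x => Y x - 1 - F x - G x) (fun x => N x * (Y x - 1 - F x)) _
    (fun x => by
      have := (((hY x).sub_const 1).sub (hFd x)).sub (hGd x)
      rwa [show N x * Y x - N x - N x * F x = N x * (Y x - 1 - F x) by noncomm_ring] at this)
    (by simp [hY0, hF0, hG0]) (fun x h0 h1 => hmul x _ _ (b2 x h0 h1))
  have hGF : τ (G 1) = 1/2 * τ (F 1 * F 1) := by
    have hd : ∀ x, HasDerivAt (fun x => τ (G x) - 1/2 * τ (F x * F x)) 0 x := by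
      intro x
      have h1 := τ.hasFDerivAt.comp_hasDerivAt x (hGd x)
      have h2 := τ.hasFDerivAt.comp_hasDerivAt x ((hFd x).mul (hFd x))
      have h3 := h1.sub (h2.const_mul (1/2))
      have e : τ (N x * F x) - 1/2 * τ (N x * F x + F x * N x) = 0 := by
        rw [map_add, hτ (F x) (N x)]; ring
      rw [e] at h3
      exact h3
    have := is_const_of_deriv_eq_zero (fun x => (hd x).differentiableAt) (fun x => (hd x).deriv) 1 0
    simp only [hF0, hG0] at this
    simp at this
    linarith
  have b4 := (hT _).trans (mul_le_mul_of_nonneg_left (b3 1 zero_le_one le_rfl) hT0)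
  rw [← hτe] at b4
  simp only [map_sub, hGF] at b4
  simp only [hτe] at b4
  exact b4

theorem gap_lip {A : Type*} [NormedRing A] [NormedAlgebra ℝ A]
    (N N' : ℝ → A) (hb : ∀ x, ‖N x‖ ≤ 1/2) (η : ℝ) (hη : ∀ x, ‖N x - N' x‖ ≤ η)
    (Y Z : ℝ → A) (h0 : Y 0 = Z 0) (hY : ∀ x, HasDerivAt Y (N x * Y x) x)
    (hZ : ∀ x, HasDerivAt Z (N' x * Z x) x)
    (hZb : ∀ x, ‖Z x‖ ≤ 2 * ‖(1:A)‖ * Real.cosh x) :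
    ‖Y 1 - Z 1‖ ≤ (4 * ‖(1:A)‖ / (1/2) * (Real.exp (1/2) - 1)) * η := by
  have hη0 : 0 ≤ η := (norm_nonneg _).trans (hη 0)
  have hd : ∀ x, HasDerivAt (fun x => Y x - Z x) (N x * Y x - N' x * Z x) x :=
    fun x => (hY x).sub (hZ x)
  have := norm_le_gronwallBound_of_norm_deriv_right_le (f := fun x => Y x - Z x)
    (f' := fun x => N x * Y x - N' x * Z x) (δ := 0) (K := 1/2) (ε := η * (4 * ‖(1:A)‖))
    (a := 0) (b := 1) (fun x _ => (hd x).continuousAt.continuousWithinAt)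
    (fun x _ => (hd x).hasDerivWithinAt) (by simp [h0]) (by
      intro x hx
      have e : N x * Y x - N' x * Z x = N x * (Y x - Z x) + (N x - N' x) * Z x := by noncomm_ring
      rw [e]
      refine (norm_add_le _ _).trans (add_le_add ?_ ?_)
      · exact (norm_mul_le _ _).trans (mul_le_mul_of_nonneg_right (hb x) (norm_nonneg _))
      · refine (norm_mul_le _ _).trans (mul_le_mul (hη x) ?_ (norm_nonneg _) hη0)
        have := gap_cosh_le hx.1 hx.2.le
        have h3 := norm_nonneg (1:A)
        have := hZb x
        nlinarith) 1 ⟨zero_le_one, le_rfl⟩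
  rw [gronwallBound_of_K_ne_0 (by norm_num)] at this
  refine this.trans (le_of_eq ?_)
  norm_num
  ring

theorem gap_ivt_one (lam m r C₂ : ℝ) (hlam : lam ≠ 0) (hm : 0 < m) (hr : 0 < r) (hC₂ : 0 < C₂) :
    ∃ δ₀ > (0:ℝ), ∃ C > (0:ℝ), ∀ f : ℝ → ℝ → ℝ,
    (∀ δ μ, |δ| ≤ r → |μ| ≤ r →
      |f δ μ - (2 - (μ ^ 2 - δ ^ 2 * m ^ 2) / lam ^ 2)| ≤ C₂ * (|μ| + |δ|) ^ 3) →
    (∀ δ, |δ| ≤ r → ContinuousOn (f δ) (Set.Icc (-r) r)) →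
    ∀ δ : ℝ, 0 < |δ| → |δ| < δ₀ → ∀ q : ℝ, |q| ≤ |δ| →
      |δ| ≤ r ∧ ∃ μ, |μ| ≤ r ∧ f δ μ = 2 * Real.cos q ∧
        |μ - Real.sqrt (δ ^ 2 * m ^ 2 + q ^ 2 * lam ^ 2)| ≤ C * δ ^ 2 := by
  have hl2 : 0 < lam ^ 2 := by positivity
  have hla : 0 < |lam| := abs_pos.2 hlam
  set S := m + |lam| with hS
  have hSpos : 0 < S := by positivity
  set C₃ := C₂ * (S + m + 1) ^ 3 + 1 with hC₃
  have hC₃pos : 0 < C₃ := by positivity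
  set C := C₃ * lam ^ 2 / m with hC
  have hCpos : 0 < C := by positivity
  have hCm : C * m = C₃ * lam ^ 2 := by rw [hC]; field_simp
  refine ⟨min (min 1 r) (min (m / C) (r / (S + m))), by positivity, C, hCpos, ?_⟩
  intro f hf hfc δ hδ0 hδ q hq
  simp only [lt_min_iff] at hδ
  obtain ⟨⟨h1, h2⟩, h3, h4⟩ := hδ
  rw [lt_div_iff₀ hCpos] at h3
  rw [lt_div_iff₀ (by positivity)] at h4
  set d := |δ| with hd
  have hdd : δ ^ 2 = d ^ 2 := (sq_abs δ).symm
  have hqq : q ^ 2 ≤ d ^ 2 := by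
    rw [← hdd]; exact sq_le_sq.2 hq
  refine ⟨h2.le, ?_⟩
  set s := Real.sqrt (δ ^ 2 * m ^ 2 + q ^ 2 * lam ^ 2) with hs
  have hs2 : s ^ 2 = δ ^ 2 * m ^ 2 + q ^ 2 * lam ^ 2 := Real.sq_sqrt (by positivity)
  have hs0 : 0 ≤ s := Real.sqrt_nonneg _
  have hsm : m * d ≤ s := by
    apply Real.le_sqrt_of_sq_le
    rw [hdd]
    have : 0 ≤ q ^ 2 * lam ^ 2 := by positivity
    nlinarith
  have hsS : s ≤ S * d := by
    apply Real.sqrt_le_iff.2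
    refine ⟨by positivity, ?_⟩
    rw [hdd, hS]
    have e1 : q ^ 2 * lam ^ 2 ≤ d ^ 2 * lam ^ 2 := by gcongr
    have e2 : |lam| ^ 2 = lam ^ 2 := sq_abs lam
    have e3 : 0 ≤ m * |lam| * d ^ 2 := by positivity
    nlinarith
  rw [hdd]
  have hCd : C * d ^ 2 ≤ m * d := by nlinarith
  have hcos : |2 * Real.cos q - (2 - q ^ 2)| ≤ d ^ 3 := by
    have := Real.cos_bound (x := q) (hq.trans h1.le)
    have hq4 : |q| ^ 4 ≤ d ^ 3 := by
      calc |q| ^ 4 ≤ d ^ 4 := by gcongr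
        _ = d ^ 3 * d := by ring
        _ ≤ d ^ 3 * 1 := by gcongr
        _ = d ^ 3 := by ring
    have h0 : 0 ≤ |q| ^ 4 := by positivity
    rw [abs_le] at this ⊢
    constructor <;> linarith
  -- general estimate
  have key : ∀ μ, |μ| ≤ (S + m) * d →
      |f δ μ - 2 * Real.cos q + (μ ^ 2 - s ^ 2) / lam ^ 2| ≤ C₃ * d ^ 3 := by
    intro μ hμ
    have e1 := hf δ μ h2.le (hμ.trans (by linarith))
    have e2 : C₂ * (|μ| + |δ|) ^ 3 ≤ C₂ * (S + m + 1) ^ 3 * d ^ 3 := by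
      rw [mul_assoc, ← mul_pow]
      gcongr
      linarith
    have e3 : (μ ^ 2 - s ^ 2) / lam ^ 2 = (μ ^ 2 - δ ^ 2 * m ^ 2) / lam ^ 2 - q ^ 2 := by
      rw [hs2]; field_simp; ring
    rw [e3, hC₃]
    have e4 := e1.trans e2
    rw [abs_le] at e4 hcos ⊢
    constructor <;> linarith
  have hd2 : 0 ≤ C * d ^ 2 := by positivity
  have hmd : 0 ≤ m * d := by positivity
  have hSd : 0 ≤ S * d := by positivity
  have ha : |s - C * d ^ 2| ≤ (S + m) * d := by
    rw [abs_le, add_mul]; constructor <;> linarith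
  have hb : |s + C * d ^ 2| ≤ (S + m) * d := by
    rw [abs_le, add_mul]; constructor <;> linarith
  have ka := key _ ha
  have kb := key _ hb
  have ga : 2 * Real.cos q ≤ f δ (s - C * d ^ 2) := by
    have : C₃ * d ^ 3 ≤ -(((s - C * d ^ 2) ^ 2 - s ^ 2) / lam ^ 2) := by
      rw [← neg_div, le_div_iff₀ hl2]
      have e : C₃ * d ^ 3 * lam ^ 2 = C * d ^ 2 * (m * d) := by
        linear_combination (-d ^ 3) * hCm
      rw [e, show -((s - C * d ^ 2) ^ 2 - s ^ 2) = C * d ^ 2 * (2 * s - C * d ^ 2) by ring]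
      exact mul_le_mul_of_nonneg_left (by linarith) hd2
    rw [abs_le] at ka
    linarith
  have gb : f δ (s + C * d ^ 2) ≤ 2 * Real.cos q := by
    have : C₃ * d ^ 3 ≤ (((s + C * d ^ 2) ^ 2 - s ^ 2) / lam ^ 2) := by
      rw [le_div_iff₀ hl2]
      have e : C₃ * d ^ 3 * lam ^ 2 = C * d ^ 2 * (m * d) := by
        linear_combination (-d ^ 3) * hCm
      rw [e, show (s + C * d ^ 2) ^ 2 - s ^ 2 = C * d ^ 2 * (2 * s + C * d ^ 2) by ring]
      exact mul_le_mul_of_nonneg_left (by linarith) hd2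
    rw [abs_le] at kb
    linarith
  have hle : s - C * d ^ 2 ≤ s + C * d ^ 2 := by
    have : 0 ≤ C * d ^ 2 := by positivity
    linarith
  have hsub : Set.Icc (s - C * d ^ 2) (s + C * d ^ 2) ⊆ Set.Icc (-r) r := by
    intro μ hμ
    rw [abs_le] at ha hb
    exact ⟨by linarith [hμ.1], by linarith [hμ.2]⟩
  obtain ⟨μ, hμ, hfμ⟩ := intermediate_value_Icc' hle ((hfc δ h2.le).mono hsub) ⟨gb, ga⟩
  refine ⟨μ, abs_le.2 (hsub hμ), hfμ, ?_⟩
  rw [abs_le]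
  exact ⟨by linarith [hμ.1], by linarith [hμ.2]⟩

theorem gap_contDiff_two (Φ Φ' Φ'' : ℝ → ℂ) (h1 : ∀ x, HasDerivAt Φ (Φ' x) x)
    (h2 : ∀ x, HasDerivAt Φ' (Φ'' x) x) (h3 : Continuous Φ'') :
    ContDiff ℝ 2 Φ ∧ deriv (deriv Φ) = Φ'' := by
  have e1 : deriv Φ = Φ' := funext fun x => (h1 x).deriv
  have e2 : deriv Φ' = Φ'' := funext fun x => (h2 x).deriv
  refine ⟨?_, by rw [e1, e2]⟩
  have : (2 : WithTop ℕ∞) = 1 + 1 := by norm_num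
  rw [this, contDiff_succ_iff_deriv]
  refine ⟨fun x => (h1 x).differentiableAt, by simp, ?_⟩
  rw [e1, contDiff_one_iff_deriv]
  exact ⟨fun x => (h2 x).differentiableAt, by rw [e2]; exact h3⟩

section
open scoped Matrix.Norms.Operator

noncomputable def gapB (u v : ℝ → ℝ) (x : ℝ) : Matrix (Fin 2) (Fin 2) ℝ :=
  !![-(u x * v x), -(v x * v x); u x * u x, u x * v x]

noncomputable def gapEntry (i j : Fin 2) : Matrix (Fin 2) (Fin 2) ℝ →L[ℝ] ℝ :=
  LinearMap.toContinuousLinearMap (Matrix.entryLinearMap ℝ ℝ i j)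

theorem gapEntry_apply (i j : Fin 2) (M : Matrix (Fin 2) (Fin 2) ℝ) : gapEntry i j M = M i j := rfl

theorem gap_entry_le (M : Matrix (Fin 2) (Fin 2) ℝ) (i j : Fin 2) : |M i j| ≤ ‖M‖ := by
  rw [Matrix.linfty_opNorm_def, ← Real.norm_eq_abs, ← coe_nnnorm, NNReal.coe_le_coe]
  exact (Finset.single_le_sum (f := fun j => ‖M i j‖₊) (fun _ _ => by positivity)
    (Finset.mem_univ j)).trans
    (Finset.le_sup (f := fun i => ∑ j, ‖M i j‖₊) (Finset.mem_univ i))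

theorem gap_periodic_bdd {A : Type*} [NormedAddCommGroup A] (g : ℝ → A) (hg : Continuous g)
    (hp : ∀ x, g (x + 1) = g x) : ∃ C > 0, ∀ x, ‖g x‖ ≤ C := by
  have hc : IsCompact (Set.range g) :=
    Function.Periodic.compact_of_continuous (c := 1) hp one_ne_zero hg
  obtain ⟨C, hC, h⟩ := hc.isBounded.exists_pos_norm_le
  exact ⟨C, hC, fun x => h _ ⟨x, rfl⟩⟩

/-- Solutions from the monodromy matrix. -/
theorem gap_floquet (Q u v u' v' U : ℝ → ℝ) (ω : ℝ) (hω : ω ≠ 0)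
    (hu : ∀ x, HasDerivAt u (u' x) x) (hv : ∀ x, HasDerivAt v (v' x) x)
    (hu' : ∀ x, HasDerivAt u' (Q x * u x) x) (hv' : ∀ x, HasDerivAt v' (Q x * v x) x)
    (hQ : Continuous Q) (hU : Continuous U)
    (hw : ∀ x, u x * v' x - u' x * v x = ω)
    (hup : ∀ x, u (x + 1) = - u x) (hvp : ∀ x, v (x + 1) = - v x)
    (hUp : ∀ x, U (x + 1) = U x)
    (Y : ℝ → Matrix (Fin 2) (Fin 2) ℝ) (K : ℝ) (hK : ∀ x, ‖(U x / ω) • gapB u v x‖ ≤ K)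
    (hY0 : Y 0 = 1) (hY : ∀ x, HasDerivAt Y (((U x / ω) • gapB u v x) * Y x) x)
    (q : ℝ) (htr : (Y 1).trace = 2 * Real.cos q) :
    ∃ Φ : ℝ → ℂ, ContDiff ℝ 2 Φ ∧ Φ ≠ 0 ∧
      (∀ x, deriv (deriv Φ) x = ((Q x : ℂ) + (U x : ℂ)) * Φ x) ∧
      (∀ x, Φ (x + 1) = - Complex.exp (Complex.I * (q : ℂ)) * Φ x) := by
  have hBp : ∀ x, (U (x + 1) / ω) • gapB u v (x + 1) = (U x / ω) • gapB u v x := by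
    intro x
    simp [gapB, hup, hvp, hUp]
  have hmono : ∀ x, Y (x + 1) = Y x * Y 1 := by
    have := gap_ode_unique (fun x => (U x / ω) • gapB u v x) K hK (fun x => Y (x + 1))
      (fun x => Y x * Y 1) (fun x => by
        have := (hY (x + 1)).comp_add_const x 1
        rwa [hBp] at this)
      (fun x => by
        have := (hY x).mul_const (Y 1)
        rwa [mul_assoc] at this) (by simp [hY0])
    exact fun x => congrFun this x
  have hent : ∀ i j x, HasDerivAt (fun x => Y x i j)
      ((((U x / ω) • gapB u v x) * Y x) i j) x := fun i j x =>
    (gapEntry i j).hasFDerivAt.comp_hasDerivAt x (hY x)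
  have h0 : ∀ j x, HasDerivAt (fun x => Y x 0 j)
      ((U x / ω) * (-(v x) * (u x * Y x 0 j + v x * Y x 1 j))) x := fun j x => by
    refine (hent 0 j x).congr_deriv ?_
    simp [gapB, Matrix.mul_apply, Fin.sum_univ_two]; ring
  have h1 : ∀ j x, HasDerivAt (fun x => Y x 1 j)
      ((U x / ω) * (u x * (u x * Y x 0 j + v x * Y x 1 j))) x := fun j x => by
    refine (hent 1 j x).congr_deriv ?_
    simp [gapB, Matrix.mul_apply, Fin.sum_univ_two]; ring
  have hdet : Y 1 0 0 * Y 1 1 1 - Y 1 0 1 * Y 1 1 0 = 1 := by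
    have hd : ∀ x, HasDerivAt (fun x => Y x 0 0 * Y x 1 1 - Y x 0 1 * Y x 1 0) 0 x := by
      intro x
      refine (((h0 0 x).mul (h1 1 x)).sub ((h0 1 x).mul (h1 0 x))).congr_deriv ?_
      ring
    have := is_const_of_deriv_eq_zero (fun x => (hd x).differentiableAt) (fun x => (hd x).deriv) 1 0
    simpa [hY0] using this
  rw [Matrix.trace_fin_two] at htr
  set z := Complex.exp (Complex.I * (q : ℂ)) with hz
  have hzz : z * z - ((Y 1 0 0 : ℂ) + (Y 1 1 1 : ℂ)) * z + 1 = 0 := by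
    have e1 : ((Y 1 0 0 : ℂ) + (Y 1 1 1 : ℂ)) = Complex.exp (Complex.I * q) +
        Complex.exp (-(Complex.I * q)) := by
      rw [← Complex.ofReal_add, htr]
      push_cast
      rw [Complex.two_cos, mul_comm (q:ℂ) Complex.I, neg_mul, mul_comm (q:ℂ) Complex.I]
    have e2 : Complex.exp (Complex.I * q) * Complex.exp (-(Complex.I * q)) = 1 := by
      rw [← Complex.exp_add]; simp
    rw [e1, hz]
    linear_combination -e2
  obtain ⟨c, hc0, hc⟩ := (Matrix.exists_mulVec_eq_zero_iff
    (M := !![(Y 1 0 0 : ℂ) - z, (Y 1 0 1 : ℂ); (Y 1 1 0 : ℂ), (Y 1 1 1 : ℂ) - z])).2 (by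
      rw [Matrix.det_fin_two_of]
      have : (Y 1 0 0 : ℂ) * Y 1 1 1 - Y 1 0 1 * Y 1 1 0 = 1 := by exact_mod_cast hdet
      linear_combination hzz + this)
  have hc1 := congrFun hc 0
  have hc2 := congrFun hc 1
  simp [Matrix.mulVec, dotProduct, Fin.sum_univ_two] at hc1 hc2
  set a : ℝ → ℂ := fun x => (Y x 0 0 : ℂ) * c 0 + (Y x 0 1 : ℂ) * c 1 with ha
  set b : ℝ → ℂ := fun x => (Y x 1 0 : ℂ) * c 0 + (Y x 1 1 : ℂ) * c 1 with hb
  have had : ∀ x, HasDerivAt a ((U x / ω : ℂ) * (-(v x : ℂ) * (u x * a x + v x * b x))) x := by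
    intro x
    refine (((h0 0 x).ofReal_comp.mul_const (c 0)).add
      ((h0 1 x).ofReal_comp.mul_const (c 1))).congr_deriv ?_
    simp only [ha, hb]; push_cast; ring
  have hbd : ∀ x, HasDerivAt b ((U x / ω : ℂ) * ((u x : ℂ) * (u x * a x + v x * b x))) x := by
    intro x
    refine (((h1 0 x).ofReal_comp.mul_const (c 0)).add
      ((h1 1 x).ofReal_comp.mul_const (c 1))).congr_deriv ?_
    simp only [ha, hb]; push_cast; ring
  have hap : ∀ x, a (x + 1) = z * a x := by
    intro x
    simp only [ha, hmono, Matrix.mul_apply, Fin.sum_univ_two]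
    push_cast
    linear_combination (Y x 0 0 : ℂ) * hc1 + (Y x 0 1 : ℂ) * hc2
  have hbp : ∀ x, b (x + 1) = z * b x := by
    intro x
    simp only [hb, hmono, Matrix.mul_apply, Fin.sum_univ_two]
    push_cast
    linear_combination (Y x 1 0 : ℂ) * hc1 + (Y x 1 1 : ℂ) * hc2
  have hωc : (ω : ℂ) ≠ 0 := by exact_mod_cast hω
  have hwc : ∀ x, (u x : ℂ) * v' x - u' x * v x = ω := fun x => by exact_mod_cast hw x
  have hΦ : ∀ x, HasDerivAt (fun x => a x * u x + b x * v x) (a x * u' x + b x * v' x) x := by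
    intro x
    refine (((had x).mul (hu x).ofReal_comp).add ((hbd x).mul (hv x).ofReal_comp)).congr_deriv ?_
    ring
  have hΦ' : ∀ x, HasDerivAt (fun x => a x * u' x + b x * v' x)
      (((Q x : ℂ) + U x) * (a x * u x + b x * v x)) x := by
    intro x
    refine (((had x).mul (hu' x).ofReal_comp).add ((hbd x).mul (hv' x).ofReal_comp)).congr_deriv ?_
    push_cast
    field_simp
    linear_combination (U x : ℂ) * (a x * u x + b x * v x) * hwc x
  have hcΦ : Continuous (fun x => a x * u x + b x * v x) :=
    continuous_iff_continuousAt.2 fun x => (hΦ x).continuousAt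
  obtain ⟨hC2, hdd⟩ := gap_contDiff_two _ _ _ hΦ hΦ' (by fun_prop)
  refine ⟨_, hC2, ?_, fun x => by rw [hdd], ?_⟩
  · intro hzero
    have hz1 : ∀ x, a x * u x + b x * v x = 0 := fun x => congrFun hzero x
    have hz2 : ∀ x, a x * u' x + b x * v' x = 0 := by
      intro x
      rw [← (hΦ x).deriv, hzero]
      exact deriv_const x (0:ℂ)
    have A1 := hz1 0
    have A2 := hz2 0
    have a0 : a 0 = c 0 := by simp [ha, hY0]
    have b0 : b 0 = c 1 := by simp [hb, hY0]
    rw [a0, b0] at A1 A2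
    apply hc0
    have B0 : (ω : ℂ) * c 0 = 0 := by
      rw [← hwc 0]; linear_combination (v' 0 : ℂ) * A1 - (v 0 : ℂ) * A2
    have B1 : (ω : ℂ) * c 1 = 0 := by
      rw [← hwc 0]; linear_combination (u 0 : ℂ) * A2 - (u' 0 : ℂ) * A1
    funext i
    fin_cases i
    · simpa [hωc] using B0
    · simpa [hωc] using B1
  · intro x
    simp only [hap, hbp, hup, hvp]
    push_cast
    ring

theorem gap_real (Q u v u' v' W : ℝ → ℝ) (ω : ℝ) (hω : ω ≠ 0)
    (hu : ∀ x, HasDerivAt u (u' x) x) (hv : ∀ x, HasDerivAt v (v' x) x)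
    (hu' : ∀ x, HasDerivAt u' (Q x * u x) x) (hv' : ∀ x, HasDerivAt v' (Q x * v x) x)
    (hQ : Continuous Q) (hW : Continuous W)
    (hw : ∀ x, u x * v' x - u' x * v x = ω)
    (hup : ∀ x, u (x + 1) = - u x) (hvp : ∀ x, v (x + 1) = - v x)
    (hWp : ∀ x, W (x + 1) = W x)
    (huu : ∫ x in (0:ℝ)..1, u x * u x = 1/2) (hvv : ∫ x in (0:ℝ)..1, v x * v x = 1/2)
    (huv : ∫ x in (0:ℝ)..1, u x * v x = 0) (α β m lam : ℝ)
    (hWuu : ∫ x in (0:ℝ)..1, W x * (u x * u x) = α)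
    (hWvv : ∫ x in (0:ℝ)..1, W x * (v x * v x) = -α)
    (hWuv : ∫ x in (0:ℝ)..1, W x * (u x * v x) = β)
    (hm : 4 * (α ^ 2 + β ^ 2) = m ^ 2) (hlam : lam ^ 2 = 4 * ω ^ 2) :
    ∃ r > 0, ∃ C₂ > 0, ∃ f : ℝ → ℝ → ℝ,
    (∀ δ μ, |δ| ≤ r → |μ| ≤ r →
      |f δ μ - (2 - (μ ^ 2 - δ ^ 2 * m ^ 2) / lam ^ 2)| ≤ C₂ * (|μ| + |δ|) ^ 3) ∧
    (∀ δ, |δ| ≤ r → ContinuousOn (f δ) (Set.Icc (-r) r)) ∧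
    (∀ δ μ q, |δ| ≤ r → |μ| ≤ r → f δ μ = 2 * Real.cos q →
      ∃ Φ : ℝ → ℂ, ContDiff ℝ 2 Φ ∧ Φ ≠ 0 ∧
      (∀ x, deriv (deriv Φ) x = ((Q x : ℂ) + ((δ * W x - μ : ℝ) : ℂ)) * Φ x) ∧
      (∀ x, Φ (x + 1) = - Complex.exp (Complex.I * (q : ℂ)) * Φ x)) := by
  have huc : Continuous u := continuous_iff_continuousAt.2 fun x => (hu x).continuousAt
  have hvc : Continuous v := continuous_iff_continuousAt.2 fun x => (hv x).continuousAt
  have hBc : Continuous (gapB u v) := by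
    refine continuous_matrix fun i j => ?_
    fin_cases i <;> fin_cases j <;> simp [gapB] <;> fun_prop
  obtain ⟨CB, hCB, hB⟩ := gap_periodic_bdd (gapB u v) hBc (by
    intro x; simp [gapB, hup, hvp])
  obtain ⟨CW, hCW, hWb⟩ := gap_periodic_bdd W hW hWp
  have hωa : 0 < |ω| := abs_pos.2 hω
  set K0 := (CW + 1) * CB / |ω| with hK0
  have hK0pos : 0 < K0 := by positivity
  set N : ℝ → ℝ → ℝ → Matrix (Fin 2) (Fin 2) ℝ :=
    fun δ μ x => ((δ * W x - μ) / ω) • gapB u v x with hN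
  have hNc : ∀ δ μ, Continuous (N δ μ) := fun δ μ => by
    have : Continuous fun x => (δ * W x - μ) / ω := by fun_prop
    exact this.smul hBc
  have hNb : ∀ δ μ x, ‖N δ μ x‖ ≤ K0 * (|μ| + |δ|) := by
    intro δ μ x
    simp only [hN]
    rw [norm_smul, Real.norm_eq_abs, abs_div]
    have e1 : |δ * W x - μ| ≤ (CW + 1) * (|μ| + |δ|) := by
      have h1 : |δ * W x - μ| ≤ |δ * W x| + |μ| := abs_sub _ _
      have h2 : |δ * W x| ≤ |δ| * CW := by
        rw [abs_mul]; exact mul_le_mul_of_nonneg_left (hWb x) (abs_nonneg _)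
      have h3 : 0 ≤ CW * |μ| := by positivity
      have h4 := abs_nonneg δ
      linarith
    calc |δ * W x - μ| / |ω| * ‖gapB u v x‖ ≤ (CW + 1) * (|μ| + |δ|) / |ω| * CB := by
          gcongr
          exact hB x
      _ = K0 * (|μ| + |δ|) := by rw [hK0]; ring
  set r := 1 / (4 * K0) with hr
  have hrpos : 0 < r := by positivity
  have hNh : ∀ δ μ, |δ| ≤ r → |μ| ≤ r → ∀ x, ‖N δ μ x‖ ≤ 1/2 := by
    intro δ μ h1 h2 x
    refine (hNb δ μ x).trans ?_
    calc K0 * (|μ| + |δ|) ≤ K0 * (r + r) := by gcongr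
      _ = 1/2 := by rw [hr]; field_simp; norm_num
  have hex : ∀ δ μ, ∃ Y : ℝ → Matrix (Fin 2) (Fin 2) ℝ, |δ| ≤ r → |μ| ≤ r →
      Y 0 = 1 ∧ (∀ x, HasDerivAt Y (N δ μ x * Y x) x) ∧
      ∀ x, ‖Y x‖ ≤ 2 * ‖(1:Matrix (Fin 2) (Fin 2) ℝ)‖ * Real.cosh x := by
    intro δ μ
    by_cases h : |δ| ≤ r ∧ |μ| ≤ r
    · obtain ⟨Y, hY⟩ := gap_ode_exists (N δ μ) (hNc δ μ) (hNh δ μ h.1 h.2)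
      exact ⟨Y, fun _ _ => hY⟩
    · exact ⟨0, fun h1 h2 => (h ⟨h1, h2⟩).elim⟩
  choose Y hY using hex
  obtain ⟨τ, hτa⟩ : ∃ τ : Matrix (Fin 2) (Fin 2) ℝ → ℝ, ∀ M, τ M = M 0 0 + M 1 1 :=
    ⟨fun M => M 0 0 + M 1 1, fun _ => rfl⟩
  have hτT : ∀ M, |τ M| ≤ 2 * ‖M‖ := by
    intro M
    rw [hτa]
    have := abs_add_le (M 0 0) (M 1 1)
    have := gap_entry_le M 0 0
    have := gap_entry_le M 1 1
    linarith
  have hτc : ∀ a b, τ (a * b) = τ (b * a) := by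
    intro a b
    simp only [hτa, Matrix.mul_apply, Fin.sum_univ_two]; ring
  set C₂ := 2 * (4 * ‖(1:Matrix (Fin 2) (Fin 2) ℝ)‖) * K0 ^ 3 + 1 with hC₂
  have hC₂pos : 0 < C₂ := by positivity
  refine ⟨r, hrpos, C₂, hC₂pos, fun δ μ => τ (Y δ μ 1), ?_, ?_, ?_⟩
  · intro δ μ h1 h2
    obtain ⟨y0, y1, y2⟩ := hY δ μ h1 h2
    obtain ⟨J, hJ⟩ : ∃ J, J = ∫ t in (0:ℝ)..1, N δ μ t := ⟨_, rfl⟩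
    have key : |τ (Y δ μ 1) - τ 1 - τ J - 1/2 * τ (J * J)| ≤ 2 * (K0 * (|μ| + |δ|) *
      (K0 * (|μ| + |δ|) * (K0 * (|μ| + |δ|) * (4 * ‖(1:Matrix (Fin 2) (Fin 2) ℝ)‖)))) := by
      rw [hJ]
      exact gap_expand (N δ μ) (hNc δ μ) _ (hNb δ μ) τ
        (fun a b => by simp only [hτa, Matrix.add_apply]; ring)
        (fun c a => by simp only [hτa, Matrix.smul_apply, smul_eq_mul]; ring)
        2 zero_le_two hτT hτc _ y0 y1 y2
    have hJe : ∀ i j, J i j = ∫ t in (0:ℝ)..1, N δ μ t i j := fun i j => by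
      rw [hJ]
      exact ((gapEntry i j).intervalIntegral_comp_comm ((hNc δ μ).intervalIntegrable 0 1)).symm
    have hIntegral : ∀ g : ℝ → ℝ, Continuous g → ∫ t in (0:ℝ)..1, (δ * W t - μ) / ω * g t =
        (δ * (∫ t in (0:ℝ)..1, W t * g t) - μ * ∫ t in (0:ℝ)..1, g t) / ω := by
      intro g hg
      rw [← intervalIntegral.integral_const_mul, ← intervalIntegral.integral_const_mul,
        ← intervalIntegral.integral_sub (Continuous.intervalIntegrable (by fun_prop) _ _)
          (Continuous.intervalIntegrable (by fun_prop) _ _), ← intervalIntegral.integral_div]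
      congr 1
      funext t
      ring
    have J00 : J 0 0 = -(δ * β) / ω := by
      rw [hJe, ← hWuv]
      have := hIntegral (fun t => u t * v t) (by fun_prop)
      rw [huv] at this
      have e : ∀ t, N δ μ t 0 0 = -((δ * W t - μ) / ω * (u t * v t)) := by
        intro t; simp [hN, gapB]
      simp only [e]
      rw [intervalIntegral.integral_neg, this]; ring
    have J11 : J 1 1 = (δ * β) / ω := by
      rw [hJe, ← hWuv]
      have := hIntegral (fun t => u t * v t) (by fun_prop)
      rw [huv] at this
      have e : ∀ t, N δ μ t 1 1 = ((δ * W t - μ) / ω * (u t * v t)) := by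
        intro t; simp [hN, gapB]
      simp only [e]
      rw [this]; ring
    have J01 : J 0 1 = (δ * α + μ / 2) / ω := by
      rw [hJe]
      have := hIntegral (fun t => v t * v t) (by fun_prop)
      rw [hvv, hWvv] at this
      have e : ∀ t, N δ μ t 0 1 = -((δ * W t - μ) / ω * (v t * v t)) := by
        intro t; simp [hN, gapB]
      simp only [e]
      rw [intervalIntegral.integral_neg, this]; ring
    have J10 : J 1 0 = (δ * α - μ / 2) / ω := by
      rw [hJe]
      have := hIntegral (fun t => u t * u t) (by fun_prop)
      rw [huu, hWuu] at this
      have e : ∀ t, N δ μ t 1 0 = ((δ * W t - μ) / ω * (u t * u t)) := by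
        intro t; simp [hN, gapB]
      simp only [e]
      rw [this]; ring
    have e1 : τ 1 = 2 := by rw [hτa]; norm_num
    have e2 : τ J = 0 := by rw [hτa, J00, J11]; ring
    have e3 : 1/2 * τ (J * J) = -((μ ^ 2 - δ ^ 2 * m ^ 2) / lam ^ 2) := by
      rw [hτa, Matrix.mul_apply, Matrix.mul_apply, Fin.sum_univ_two, Fin.sum_univ_two, J00, J11,
        J01, J10, hlam, ← hm]
      field_simp
      ring
    rw [e1, e2, e3] at key
    change |τ (Y δ μ 1) - (2 - (μ ^ 2 - δ ^ 2 * m ^ 2) / lam ^ 2)| ≤ _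
    rw [show τ (Y δ μ 1) - (2 - (μ ^ 2 - δ ^ 2 * m ^ 2) / lam ^ 2) =
      τ (Y δ μ 1) - 2 - 0 - -((μ ^ 2 - δ ^ 2 * m ^ 2) / lam ^ 2) by ring]
    refine key.trans ?_
    rw [hC₂, add_mul]
    have : 0 ≤ 1 * (|μ| + |δ|) ^ 3 := by positivity
    refine le_trans (le_of_eq ?_) (le_add_of_nonneg_right this)
    ring
  · intro δ h1
    set D := 4 * ‖(1:Matrix (Fin 2) (Fin 2) ℝ)‖ / (1/2) * (Real.exp (1/2) - 1) with hD
    have hDn : 0 ≤ D := by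
      have : 1 ≤ Real.exp (1/2) := Real.one_le_exp (by norm_num)
      have : 0 ≤ Real.exp (1/2) - 1 := by linarith
      positivity
    have hL : 0 ≤ 2 * (D * (CB / |ω|)) := by positivity
    refine LipschitzOnWith.continuousOn (K := ⟨2 * (D * (CB / |ω|)), hL⟩) ?_
    refine LipschitzOnWith.of_dist_le_mul fun μ hμ ν hν => ?_
    have hμ' := abs_le.2 hμ
    have hν' := abs_le.2 hν
    obtain ⟨y0, y1, y2⟩ := hY δ μ h1 hμ'
    obtain ⟨z0, z1, z2⟩ := hY δ ν h1 hν'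
    have := gap_lip (N δ μ) (N δ ν) (hNh δ μ h1 hμ') (CB / |ω| * |μ - ν|) (by
      intro x
      simp only [hN]
      rw [← sub_smul, norm_smul, Real.norm_eq_abs,
        show (δ * W x - μ) / ω - (δ * W x - ν) / ω = -((μ - ν) / ω) by ring, abs_neg, abs_div]
      calc |μ - ν| / |ω| * ‖gapB u v x‖ ≤ |μ - ν| / |ω| * CB := by
            gcongr
            exact hB x
        _ = _ := by ring) _ _ (y0.trans z0.symm) y1 z1 z2
    rw [Real.dist_eq, Real.dist_eq,
      show τ (Y δ μ 1) - τ (Y δ ν 1) = τ (Y δ μ 1 - Y δ ν 1) by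
        simp only [hτa, Matrix.sub_apply]; ring]
    refine (hτT _).trans ?_
    refine (mul_le_mul_of_nonneg_left this zero_le_two).trans (le_of_eq ?_)
    change _ = 2 * (D * (CB / |ω|)) * |μ - ν|
    ring
  · intro δ μ q h1 h2 hq
    obtain ⟨y0, y1, y2⟩ := hY δ μ h1 h2
    exact gap_floquet Q u v u' v' (fun x => δ * W x - μ) ω hω hu hv hu' hv' hQ (by fun_prop) hw
      hup hvp (by intro x; simp [hWp]) (Y δ μ) (1/2) (hNh δ μ h1 h2) y0 y1 q
      (by rw [Matrix.trace_fin_two, ← hτa]; exact hq)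

end

theorem gap_second_unique (Q p p' : ℝ → ℝ) (K : ℝ) (hK : ∀ x, |Q x| ≤ K)
    (h1 : ∀ x, HasDerivAt p (p' x) x) (h2 : ∀ x, HasDerivAt p' (Q x * p x) x)
    (h0 : p 0 = 0) (h0' : p' 0 = 0) : ∀ x, p x = 0 := by
  have hK0 : 0 ≤ K := (abs_nonneg _).trans (hK 0)
  have : (fun x => (p x, p' x)) = fun _ => ((0:ℝ), (0:ℝ)) := by
    refine ODE_solution_unique_univ (v := fun x (y : ℝ × ℝ) => (y.2, Q x * y.1))
      (K := ⟨K + 1, by positivity⟩) (s := fun _ => Set.univ) (t₀ := 0) ?_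
      (fun t => ⟨(h1 t).prodMk (h2 t), trivial⟩) (fun t => ⟨?_, trivial⟩) (by simp [h0, h0'])
    · intro t
      refine (LipschitzWith.of_dist_le_mul fun a b => ?_).lipschitzOnWith
      change _ ≤ (K + 1) * dist a b
      rw [dist_eq_norm, dist_eq_norm, Prod.norm_def, Prod.norm_def]
      simp only [Prod.fst_sub, Prod.snd_sub, Real.norm_eq_abs, ← mul_sub, abs_mul]
      have e1 := le_max_left |a.1 - b.1| |a.2 - b.2|
      have e2 := le_max_right |a.1 - b.1| |a.2 - b.2|
      have e3 := abs_nonneg (a.1 - b.1)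
      have e4 := hK t
      apply max_le
      · nlinarith
      · nlinarith
    · exact (hasDerivAt_const t ((0:ℝ), (0:ℝ))).congr_deriv (by simp; rfl)
  intro x
  exact congrArg Prod.fst (congrFun this x)

theorem gap_shift (g : ℝ → ℝ) (hg : ∀ x, g (x + 1) = g x) :
    ∫ x in (0:ℝ)..1, g (x + 1/2) = ∫ x in (0:ℝ)..1, g x := by
  rw [intervalIntegral.integral_comp_add_right]
  have hp : Function.Periodic g 1 := hg
  have := hp.intervalIntegral_add_eq (0 + 1/2) 0
  rw [show (1:ℝ) + 1/2 = 0 + 1/2 + 1 by norm_num, this]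
  norm_num


/-- Gap opening at a Dirac point due to breaking of inversion symmetry. -/
theorem gap_opening_at_dirac_point
    (V W : ℝ → ℝ)
    (hV : ContDiff ℝ (⊤ : ℕ∞) V) (hVeven : ∀ x, V (-x) = V x) (hVhalf : ∀ x, V (x + 1/2) = V x)
    (hW : ContDiff ℝ (⊤ : ℕ∞) W) (hWeven : ∀ x, W (-x) = W x) (hWper : ∀ x, W (x + 1) = W x)
    (hWhalf : ∀ x, W (x + 1/2) = -W x)
    (Estar : ℝ) (Φ₁ : ℝ → ℂ)
    (hΦ₁ : ContDiff ℝ 2 Φ₁) (hΦ₁ne : Φ₁ ≠ 0)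
    (hΦ₁eq : ∀ x, -(deriv (deriv Φ₁) x) + (V x : ℂ) * Φ₁ x = (Estar : ℂ) * Φ₁ x)
    (hΦ₁pp : ∀ x, Φ₁ (x + 1/2) = Complex.I * Φ₁ x)
    (hΦ₁norm : (∫ x in (0:ℝ)..1, ‖Φ₁ x‖ ^ 2) = 1)
    (hsimple_e : ∀ Φ : ℝ → ℂ, ContDiff ℝ 2 Φ →
      (∀ x, -(deriv (deriv Φ) x) + (V x : ℂ) * Φ x = (Estar : ℂ) * Φ x) →
      (∀ x, Φ (x + 1/2) = Complex.I * Φ x) → ∃ c : ℂ, ∀ x, Φ x = c * Φ₁ x)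
    (hsimple_o : ∀ Φ : ℝ → ℂ, ContDiff ℝ 2 Φ →
      (∀ x, -(deriv (deriv Φ) x) + (V x : ℂ) * Φ x = (Estar : ℂ) * Φ x) →
      (∀ x, Φ (x + 1/2) = -Complex.I * Φ x) → ∃ c : ℂ, ∀ x, Φ x = c * Φ₁ (-x))
    (lam θ : ℝ)
    (hlam : (lam : ℂ) = 2 * Complex.I * ∫ x in (0:ℝ)..1, (starRingEnd ℂ) (Φ₁ x) * deriv Φ₁ x)
    (hθ : (θ : ℂ) = ∫ x in (0:ℝ)..1, (starRingEnd ℂ) (Φ₁ x) * (W x : ℂ) * Φ₁ (-x))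
    (hθne : θ ≠ 0)
    (κinf : ℝ) (hκinf : 0 < κinf) :
    ∃ δ₀ > (0:ℝ), ∃ C > (0:ℝ), ∀ δ : ℝ, 0 < |δ| → |δ| < δ₀ →
      ∀ k : ℝ, |k - Real.pi| ≤ |δ| →
        ∃ Ep Em : ℝ,
          (∃ Φ : ℝ → ℂ, ContDiff ℝ 2 Φ ∧ Φ ≠ 0 ∧
            (∀ x, -(deriv (deriv Φ) x) + ((V x : ℂ) + (δ : ℂ) * (κinf : ℂ) * (W x : ℂ)) * Φ x
              = (Ep : ℂ) * Φ x) ∧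
            (∀ x, Φ (x + 1) = Complex.exp (Complex.I * (k : ℂ)) * Φ x)) ∧
          (∃ Φ : ℝ → ℂ, ContDiff ℝ 2 Φ ∧ Φ ≠ 0 ∧
            (∀ x, -(deriv (deriv Φ) x) + ((V x : ℂ) + (δ : ℂ) * (κinf : ℂ) * (W x : ℂ)) * Φ x
              = (Em : ℂ) * Φ x) ∧
            (∀ x, Φ (x + 1) = Complex.exp (Complex.I * (k : ℂ)) * Φ x)) ∧
          |Ep - Estar - Real.sqrt (δ ^ 2 * κinf ^ 2 * θ ^ 2 + (k - Real.pi) ^ 2 * lam ^ 2)|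
            ≤ C * δ ^ 2 ∧
          |Em - Estar + Real.sqrt (δ ^ 2 * κinf ^ 2 * θ ^ 2 + (k - Real.pi) ^ 2 * lam ^ 2)|
            ≤ C * δ ^ 2 := by
  have hVc : Continuous V := hV.continuous
  have hWc : Continuous W := hW.continuous
  have hΦd : ∀ x, HasDerivAt Φ₁ (deriv Φ₁ x) x := fun x =>
    ((hΦ₁.differentiable (by norm_num)) x).hasDerivAt
  have hΦdd : ∀ x, HasDerivAt (deriv Φ₁) (((V x - Estar : ℝ) : ℂ) * Φ₁ x) x := by
    intro x
    have h2 : (2 : WithTop ℕ∞) = 1 + 1 := by norm_num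
    rw [h2, contDiff_succ_iff_deriv] at hΦ₁
    have := ((hΦ₁.2.2.differentiable (by norm_num)) x).hasDerivAt
    refine this.congr_deriv ?_
    push_cast
    linear_combination -(hΦ₁eq x)
  have hΦc : Continuous Φ₁ := hΦ₁.continuous
  obtain ⟨u, hu⟩ : ∃ u : ℝ → ℝ, ∀ x, u x = (Φ₁ x).re := ⟨_, fun _ => rfl⟩
  obtain ⟨v, hv⟩ : ∃ u : ℝ → ℝ, ∀ x, u x = (Φ₁ x).im := ⟨_, fun _ => rfl⟩
  obtain ⟨u', hu'⟩ : ∃ u : ℝ → ℝ, ∀ x, u x = (deriv Φ₁ x).re := ⟨_, fun _ => rfl⟩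
  obtain ⟨v', hv'⟩ : ∃ u : ℝ → ℝ, ∀ x, u x = (deriv Φ₁ x).im := ⟨_, fun _ => rfl⟩
  have hud : ∀ x, HasDerivAt u (u' x) x := fun x => by
    rw [show u = fun x => (Φ₁ x).re from funext hu, hu']
    exact Complex.reCLM.hasFDerivAt.comp_hasDerivAt x (hΦd x)
  have hvd : ∀ x, HasDerivAt v (v' x) x := fun x => by
    rw [show v = fun x => (Φ₁ x).im from funext hv, hv']
    exact Complex.imCLM.hasFDerivAt.comp_hasDerivAt x (hΦd x)
  have hud' : ∀ x, HasDerivAt u' ((V x - Estar) * u x) x := fun x => by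
    rw [show u' = fun x => (deriv Φ₁ x).re from funext hu', hu]
    refine (Complex.reCLM.hasFDerivAt.comp_hasDerivAt x (hΦdd x)).congr_deriv ?_
    rw [Complex.reCLM_apply, Complex.re_ofReal_mul]
  have hvd' : ∀ x, HasDerivAt v' ((V x - Estar) * v x) x := fun x => by
    rw [show v' = fun x => (deriv Φ₁ x).im from funext hv', hv]
    refine (Complex.imCLM.hasFDerivAt.comp_hasDerivAt x (hΦdd x)).congr_deriv ?_
    rw [Complex.imCLM_apply, Complex.im_ofReal_mul]
  have huc : Continuous u := continuous_iff_continuousAt.2 fun x => (hud x).continuousAt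
  have hvc : Continuous v := continuous_iff_continuousAt.2 fun x => (hvd x).continuousAt
  have huc' : Continuous u' := continuous_iff_continuousAt.2 fun x => (hud' x).continuousAt
  have hvc' : Continuous v' := continuous_iff_continuousAt.2 fun x => (hvd' x).continuousAt
  have huh : ∀ x, u (x + 1/2) = - v x := fun x => by rw [hu, hv, hΦ₁pp]; simp
  have hvh : ∀ x, v (x + 1/2) = u x := fun x => by rw [hu, hv, hΦ₁pp]; simp
  have hup : ∀ x, u (x + 1) = - u x := fun x => by
    rw [show x + 1 = x + 1/2 + 1/2 by ring, huh, hvh]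
  have hvp : ∀ x, v (x + 1) = - v x := fun x => by
    rw [show x + 1 = x + 1/2 + 1/2 by ring, hvh, huh]
  have hVp : ∀ x, V (x + 1) = V x := fun x => by
    rw [show x + 1 = x + 1/2 + 1/2 by ring, hVhalf, hVhalf]
  -- the Wronskian
  obtain ⟨ω, hωdef⟩ : ∃ ω, ω = u 0 * v' 0 - u' 0 * v 0 := ⟨_, rfl⟩
  have hw : ∀ x, u x * v' x - u' x * v x = ω := by
    have hd : ∀ x, HasDerivAt (fun x => u x * v' x - u' x * v x) 0 x := by
      intro x
      refine (((hud x).mul (hvd' x)).sub ((hud' x).mul (hvd x))).congr_deriv ?_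
      ring
    intro x
    rw [hωdef]
    exact is_const_of_deriv_eq_zero (fun x => (hd x).differentiableAt) (fun x => (hd x).deriv) x 0
  have hω : ω ≠ 0 := by
    intro h0
    obtain ⟨K, -, hK⟩ := gap_periodic_bdd (fun x => V x - Estar) (by fun_prop) (by simp [hVp])
    obtain ⟨c, hc0, hc⟩ := (Matrix.exists_mulVec_eq_zero_iff
      (M := !![u 0, v 0; u' 0, v' 0])).2 (by
        rw [Matrix.det_fin_two_of]; linarith)
    have hc1 := congrFun hc 0
    have hc2 := congrFun hc 1
    simp [Matrix.mulVec, dotProduct, Fin.sum_univ_two] at hc1 hc2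
    have hz := gap_second_unique (fun x => V x - Estar) (fun x => c 0 * u x + c 1 * v x)
      (fun x => c 0 * u' x + c 1 * v' x) K hK
      (fun x => ((hud x).const_mul _).add ((hvd x).const_mul _))
      (fun x => (((hud' x).const_mul _).add ((hvd' x).const_mul _)).congr_deriv (by ring))
      (by linarith) (by linarith)
    have hcc : c 0 ^ 2 + c 1 ^ 2 ≠ 0 := by
      intro h
      apply hc0
      have a0 : c 0 = 0 := by nlinarith [sq_nonneg (c 0), sq_nonneg (c 1)]
      have a1 : c 1 = 0 := by nlinarith [sq_nonneg (c 0), sq_nonneg (c 1)]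
      funext i
      fin_cases i
      · exact a0
      · exact a1
    apply hΦ₁ne
    funext x
    have z1 : c 0 * u x + c 1 * v x = 0 := hz x
    have z2 : c 0 * u (x + 1/2) + c 1 * v (x + 1/2) = 0 := hz (x + 1/2)
    rw [huh, hvh] at z2
    have y1 : (c 0 ^ 2 + c 1 ^ 2) * u x = 0 := by linear_combination c 0 * z1 + c 1 * z2
    have y2 : (c 0 ^ 2 + c 1 ^ 2) * v x = 0 := by linear_combination c 1 * z1 - c 0 * z2
    apply Complex.ext
    · rw [← hu]; simpa [hcc] using y1
    · rw [← hv]; simpa [hcc] using y2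
  have hlamω : lam = -2 * ω := by
    have h := congrArg Complex.re hlam
    rw [mul_assoc, Complex.ofReal_re] at h
    rw [h]
    have hcint : IntervalIntegrable (fun x => (starRingEnd ℂ) (Φ₁ x) * deriv Φ₁ x) volume 0 1 := by
      refine Continuous.intervalIntegrable ?_ _ _
      exact (Complex.continuous_conj.comp hΦc).mul
        (continuous_iff_continuousAt.2 fun x => (hΦdd x).continuousAt)
    have him := Complex.imCLM.intervalIntegral_comp_comm hcint
    simp only [Complex.imCLM_apply] at him
    have e : ∀ x, ((starRingEnd ℂ) (Φ₁ x) * deriv Φ₁ x).im = ω := by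
      intro x
      rw [← hw x, hu, hv, hu', hv']
      simp [Complex.mul_im]; ring
    simp only [e, intervalIntegral.integral_const, sub_zero, one_smul] at him
    simp [← him]
  have hlamne : lam ≠ 0 := by rw [hlamω]; simpa using hω
  -- integrals
  have huu_vv : ∫ x in (0:ℝ)..1, u x * u x = ∫ x in (0:ℝ)..1, v x * v x := by
    have := gap_shift (fun x => v x * v x) (by intro x; simp [hvp])
    simp only [hvh] at this
    exact this
  have hsum : (∫ x in (0:ℝ)..1, u x * u x) + ∫ x in (0:ℝ)..1, v x * v x = 1 := by
    rw [← intervalIntegral.integral_add (Continuous.intervalIntegrable (by fun_prop) _ _)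
      (Continuous.intervalIntegrable (by fun_prop) _ _), ← hΦ₁norm]
    congr 1
    funext x
    rw [hu, hv, ← Complex.normSq_eq_norm_sq, Complex.normSq_apply]
  have huv : ∫ x in (0:ℝ)..1, u x * v x = 0 := by
    have := gap_shift (fun x => u x * v x) (by intro x; simp [hvp, hup])
    simp only [hvh, huh] at this
    have e : ∀ x, -v x * u x = -(u x * v x) := fun x => by ring
    simp only [e, intervalIntegral.integral_neg] at this
    linarith
  obtain ⟨α, hα⟩ : ∃ α, α = ∫ x in (0:ℝ)..1, W x * (u x * u x) := ⟨_, rfl⟩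
  obtain ⟨β, hβ⟩ : ∃ β, β = ∫ x in (0:ℝ)..1, W x * (u x * v x) := ⟨_, rfl⟩
  have hWvv : ∫ x in (0:ℝ)..1, W x * (v x * v x) = -α := by
    have := gap_shift (fun x => W x * (v x * v x)) (by intro x; simp [hvp, hWper])
    simp only [hvh, hWhalf] at this
    simp only [neg_mul, intervalIntegral.integral_neg] at this
    rw [← this, hα]
  -- conjugate of Φ₁ is a multiple of the reflection
  obtain ⟨c, hc⟩ : ∃ c : ℂ, ∀ x, (starRingEnd ℂ) (Φ₁ x) = c * Φ₁ (-x) := by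
    have d1 : ∀ x, HasDerivAt (fun x => (starRingEnd ℂ) (Φ₁ x)) ((starRingEnd ℂ) (deriv Φ₁ x)) x :=
      fun x => Complex.conjCLE.toContinuousLinearMap.hasFDerivAt.comp_hasDerivAt x (hΦd x)
    have d2 : ∀ x, HasDerivAt (fun x => (starRingEnd ℂ) (deriv Φ₁ x))
        (((V x - Estar : ℝ) : ℂ) * (starRingEnd ℂ) (Φ₁ x)) x := fun x => by
      refine (Complex.conjCLE.toContinuousLinearMap.hasFDerivAt.comp_hasDerivAt x
        (hΦdd x)).congr_deriv ?_
      change (starRingEnd ℂ) (((V x - Estar : ℝ) : ℂ) * Φ₁ x) = _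
      rw [map_mul, Complex.conj_ofReal]
    have hcc : Continuous fun x => (starRingEnd ℂ) (Φ₁ x) := Complex.continuous_conj.comp hΦc
    obtain ⟨c2, c3⟩ := gap_contDiff_two _ _ _ d1 d2 (by fun_prop)
    refine hsimple_o _ c2 ?_ ?_
    · intro x
      rw [c3]; push_cast; ring
    · intro x
      rw [hΦ₁pp, map_mul, Complex.conj_I]
  have hcn : Complex.normSq c = 1 := by
    obtain ⟨x, hx⟩ := Function.ne_iff.1 hΦ₁ne
    have h1 := hc x
    have h2 := hc (-x)
    rw [neg_neg] at h2
    have h3 := congrArg Complex.normSq h1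
    have h4 := congrArg Complex.normSq h2
    rw [Complex.normSq_conj, Complex.normSq_mul] at h3 h4
    have hpos : 0 < Complex.normSq (Φ₁ x) := Complex.normSq_pos.2 hx
    have hcp : 0 ≤ Complex.normSq c := Complex.normSq_nonneg c
    rw [h4] at h3
    have h5 : Complex.normSq (Φ₁ x) * (Complex.normSq c * Complex.normSq c - 1) = 0 := by
      linear_combination -h3
    rcases mul_eq_zero.1 h5 with h | h
    · exact absurd h hpos.ne'
    · nlinarith
  have hθ2 : 4 * (α ^ 2 + β ^ 2) = θ ^ 2 := by
    have hcθ : c * θ = ∫ x in (0:ℝ)..1, (W x : ℂ) * ((starRingEnd ℂ) (Φ₁ x) * (starRingEnd ℂ) (Φ₁ x)) := by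
      rw [hθ, ← intervalIntegral.integral_const_mul]
      congr 1
      funext x
      linear_combination (-(W x : ℂ) * (starRingEnd ℂ) (Φ₁ x)) * hc x
    have hci : IntervalIntegrable (fun x => (W x : ℂ) * ((starRingEnd ℂ) (Φ₁ x) *
        (starRingEnd ℂ) (Φ₁ x))) volume 0 1 := by
      have hcc : Continuous fun x => (starRingEnd ℂ) (Φ₁ x) := Complex.continuous_conj.comp hΦc
      exact Continuous.intervalIntegrable (by fun_prop) _ _
    have hre := Complex.reCLM.intervalIntegral_comp_comm hci
    have him := Complex.imCLM.intervalIntegral_comp_comm hci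
    rw [← hcθ] at hre him
    simp only [Complex.imCLM_apply, Complex.reCLM_apply, Complex.re_ofReal_mul,
      Complex.im_ofReal_mul] at hre him
    have e1 : ∀ x, W x * ((starRingEnd ℂ) (Φ₁ x) * (starRingEnd ℂ) (Φ₁ x)).re =
        W x * (u x * u x) - W x * (v x * v x) := fun x => by
      rw [hu, hv, Complex.mul_re, Complex.conj_re, Complex.conj_im]; ring
    have e2 : ∀ x, W x * ((starRingEnd ℂ) (Φ₁ x) * (starRingEnd ℂ) (Φ₁ x)).im =
        (-2) * (W x * (u x * v x)) := fun x => by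
      rw [hu, hv, Complex.mul_im, Complex.conj_re, Complex.conj_im]; ring
    simp only [e1, e2] at hre him
    rw [intervalIntegral.integral_const_mul, ← hβ] at him
    rw [intervalIntegral.integral_sub (Continuous.intervalIntegrable (by fun_prop) _ _)
      (Continuous.intervalIntegrable (by fun_prop) _ _), ← hα, hWvv] at hre
    have hn : Complex.normSq (c * θ) = θ ^ 2 := by
      rw [Complex.normSq_mul, hcn, Complex.normSq_ofReal]; ring
    rw [← hn, Complex.normSq_apply, ← hre, ← him]
    ring
  -- the discriminant
  have hmpos : 0 < κinf * |θ| := mul_pos hκinf (abs_pos.2 hθne)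
  obtain ⟨r, hr, C₂, hC₂, f, hf1, hf2, hf3⟩ := gap_real (fun x => V x - Estar) u v u' v'
    (fun x => κinf * W x) ω hω hud hvd hud' hvd' (by fun_prop) (by fun_prop) hw hup hvp
    (by intro x; simp [hWper]) (by linarith) (by linarith) huv (κinf * α) (κinf * β) (κinf * |θ|)
    lam (by simp only [mul_assoc]; rw [intervalIntegral.integral_const_mul, hα])
    (by simp only [mul_assoc]; rw [intervalIntegral.integral_const_mul, hWvv]; ring)
    (by simp only [mul_assoc]; rw [intervalIntegral.integral_const_mul, hβ])
    (by rw [mul_pow κinf |θ|, sq_abs, ← hθ2]; ring) (by rw [hlamω]; ring)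
  obtain ⟨δ₀, hδ₀, C, hC, hmain⟩ := gap_ivt_one lam (κinf * |θ|) r C₂ hlamne hmpos hr hC₂
  refine ⟨δ₀, hδ₀, C, hC, ?_⟩
  intro δ hδ1 hδ2 k hk
  obtain ⟨hδr, μ, hμ1, hμ2, hμ3⟩ := hmain f hf1 hf2 δ hδ1 hδ2 (k - Real.pi) hk
  obtain ⟨-, ν, hν1, hν2, hν3⟩ := hmain (fun δ μ => f δ (-μ))
    (fun δ μ h1 h2 => by simpa using hf1 δ (-μ) h1 (by simpa using h2))
    (fun δ h1 => (hf2 δ h1).comp continuous_neg.continuousOn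
      (fun x hx => ⟨by linarith [hx.2], by linarith [hx.1]⟩)) δ hδ1 hδ2 (k - Real.pi) hk
  have hs : δ ^ 2 * (κinf * |θ|) ^ 2 + (k - Real.pi) ^ 2 * lam ^ 2 =
      δ ^ 2 * κinf ^ 2 * θ ^ 2 + (k - Real.pi) ^ 2 * lam ^ 2 := by
    rw [mul_pow, sq_abs]; ring
  rw [hs] at hμ3 hν3
  have hexp : -Complex.exp (Complex.I * ((k - Real.pi : ℝ) : ℂ)) = Complex.exp (Complex.I * k) := by
    push_cast
    rw [mul_sub, Complex.exp_sub, mul_comm Complex.I (Real.pi : ℂ), Complex.exp_pi_mul_I]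
    ring
  have hsol : ∀ μ, |μ| ≤ r → f δ μ = 2 * Real.cos (k - Real.pi) →
      ∃ Φ : ℝ → ℂ, ContDiff ℝ 2 Φ ∧ Φ ≠ 0 ∧
            (∀ x, -(deriv (deriv Φ) x) + ((V x : ℂ) + (δ : ℂ) * (κinf : ℂ) * (W x : ℂ)) * Φ x
              = ((Estar + μ : ℝ) : ℂ) * Φ x) ∧
            (∀ x, Φ (x + 1) = Complex.exp (Complex.I * (k : ℂ)) * Φ x) := by
    intro μ h1 h2
    obtain ⟨Φ, p1, p2, p3, p4⟩ := hf3 δ μ _ hδr h1 h2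
    refine ⟨Φ, p1, p2, ?_, ?_⟩
    · intro x
      rw [p3]; push_cast; ring
    · intro x
      rw [p4, hexp]
  refine ⟨Estar + μ, Estar + -ν, hsol μ hμ1 hμ2, hsol (-ν) (by simpa using hν1) hν2, ?_, ?_⟩
  · rw [show Estar + μ - Estar = μ by ring]; exact hμ3
  · rw [show ∀ s, Estar + -ν - Estar + s = -(ν - s) by intro s; ring, abs_neg]; exact hν3
end
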